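/- Let $\mathcal V,\mathcal X,\mathcal Y$ be finite nonempty alphabets, $P_V$ a probability distribution on $\mathcal V$ (with product extension $P^k$), $W(y|x)$ a stochastic matrix from $\mathcal X$ to $\mathcal Y$ (with product extension $W^n$), and $t>0$. Logarithms are natural. A joint source-channel code is a pair $f:\mathcal V^k\to\mathcal X^n$, $\varphi:\mathcal Y^n\to\mathcal V^k$, with error probability $p_e=\sum_{v}P^k(v)\sum_{y:\varphi(y)\neq v}W^n(y|f(v))$. The type of a sequence is its empirical distribution, and the type class of a distribution is the set of sequences (of the given length) of that type. Put $H(P)=-\sum_v P(v)\log P(v)$, $E_s(\lambda,P_V)=(1+\lambda)\log\sum_{v}P_V(v)^{1/(1+\lambda)}$, $d_B(x,\bar x)=-\log\sum_y\sqrt{W(y|x)W(y|\bar x)}\in[0,\infty]$ and, for $\rho>0$ and a probability distribution $Q$ on $\mathcal X$, $$E'_x(Q,\rho)=\min_{Q'}\Big\{-\rho\sum_x Q(x)\log\sum_{\bar x}Q'(\bar x)\,e^{-d_B(x,\bar x)/\rho}\Big\},$$ the minimum being over all probability distributions $Q'$ on $\mathcal X$, with the conventions $e^{-\infty}=0$,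 $\log 0=-\infty$, $0\cdot(-\infty)=0$ (the minimum is always finite). Let $E'_x(\lambda)=\max_Q E'_x(Q,\lambda)$, let $\overline{E}'_x$ be the concave hull of $E'_x(\cdot)$ on $[1,\infty)$, i.e. the smallest concave function on $[1,\infty)$ dominating $E'_x(\cdot)$ there, and let $$E^\star=\sup_{\lambda\ge 1}\big\{\overline{E}'_x(\lambda)-t\,E_s(\lambda,P_V)\big\}\in(-\infty,+\infty].$$ For a probability distribution $P$ on $\mathcal V$ consider the objective $$F_P(\tilde Q)=\sup_{\rho\ge1,\ \lambda>0}\big[E'_x(\tilde Q,\rho)+(\lambda-\rho)\,t\,H(P)-t\,E_s(\lambda,P_V)\big]\in(-\infty,+\infty],$$ and call $P$ regular if $F_P$ attains a finite maximum over the probability distributions $\tilde Q$ on $\mathcal X$. (Every $P$ is regular if $P_V$ has full support and $d_B$ is finite everywhere.) For every regular $P$ let $Q_P\in\operatorname{argmax}_{\tilde Q}F_P(\tilde Q)$ be any maximizer. Then $E^\star$ is achievable by codes in which the source sequences are partitioned by type and the codewords of each source type $P$ have one common composition, which approximates $Q_P$: for every real $E<E^\star$ and every $\delta>0$, for all sufficiently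 large $n$, with $k=\lfloor tn\rfloor$, there are types $\hat Q_P$ of sequences in $\mathcal X^n$, one for each type $P$ of sequences in $\mathcal V^k$, with $\max_x|\hat Q_P(x)-Q_P(x)|\le\delta$ whenever $P$ is regular, and a code $(f,\varphi)$ such that $f(v)$ lies in the type class of $\hat Q_P$ for every $v\in\mathcal V^k$ of type $P$, and $p_e\le e^{-nE}$. -/

import Mathlib

namespace JSCC

noncomputable section

/-- `W` is a discrete memoryless channel: `W x y = W(y|x)` is a stochastic matrix. -/
def IsDMC {X Y : Type*} [Fintype Y] (W : X → Y → ℝ) : Prop :=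
  ∀ x, W x ∈ stdSimplex ℝ Y

/-- Product extension of a distribution: `P^k(v) = ∏ P(vᵢ)`. -/
def prodDist {V : Type*} (P : V → ℝ) {k : ℕ} (v : Fin k → V) : ℝ := ∏ i, P (v i)

/-- Product extension of a channel: `W^n(y|x) = ∏ W(y_l|x_l)`. -/
def prodChan {X Y : Type*} (W : X → Y → ℝ) {n : ℕ} (x : Fin n → X) (y : Fin n → Y) : ℝ :=
  ∏ l, W (x l) (y l)

open scoped Classical in
/-- Error probability of the joint source-channel code `(f, φ)`. -/
def pErr {V X Y : Type*} [Fintype V] [Fintype Y] (PV : V → ℝ) (W : X → Y → ℝ) {k n : ℕ}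
    (f : (Fin k → V) → Fin n → X) (φ : (Fin n → Y) → Fin k → V) : ℝ :=
  ∑ v : Fin k → V, prodDist PV v *
    ∑ y ∈ Finset.univ.filter (fun y : Fin n → Y => φ y ≠ v), prodChan W (f v) y

open scoped Classical in
/-- Type (empirical distribution) of a sequence. -/
def empDist {α : Type*} {k : ℕ} (v : Fin k → α) : α → ℝ :=
  fun a => ((Finset.univ.filter fun i => v i = a).card : ℝ) / k

/-- Type class of `P`: the sequences of length `k` whose empirical distribution is `P`. -/
def typeClass {α : Type*} (k : ℕ) (P : α → ℝ) : Set (Fin k → α) :=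
  {v | empDist v = P}

/-- `P` is the type of some sequence of length `k`. -/
def IsType {α : Type*} (k : ℕ) (P : α → ℝ) : Prop := (typeClass k P).Nonempty

/-- Shannon entropy (natural logarithm). -/
def entH {α : Type*} [Fintype α] (P : α → ℝ) : ℝ := -∑ a, P a * Real.log (P a)

/-- Gallager's source function `E_s(ρ, P_V)`. -/
def Es {V : Type*} [Fintype V] (PV : V → ℝ) (ρ : ℝ) : ℝ :=
  (1 + ρ) * Real.log (∑ v, PV v ^ (1 / (1 + ρ)))

/-- Bhattacharyya distance, with the value `⊤` when the two output distributions have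
disjoint supports. -/
def dB {X Y : Type*} [Fintype Y] (W : X → Y → ℝ) (x x' : X) : EReal :=
  -ENNReal.log (ENNReal.ofReal (∑ y, Real.sqrt (W x y * W x' y)))

/-- Dual weak expurgated function `E'_x(Q, ρ)`. Here `exp (-∞) = 0`, `log 0 = -∞` and
`0 * (-∞) = 0`; the value is finite for `ρ > 0`, since `Q' = Q` gives a finite term. -/
def Ex' {X Y : Type*} [Fintype X] [Fintype Y] (W : X → Y → ℝ) (Q : X → ℝ) (ρ : ℝ) : EReal :=
  ⨅ Q' ∈ stdSimplex ℝ X, -(ρ : EReal) * ∑ x, (Q x : EReal) *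
    ENNReal.log (∑ x', ENNReal.ofReal (Q' x') * EReal.exp (-(dB W x x') / (ρ : EReal)))

/-- `E'_x(ρ) = max_Q E'_x(Q, ρ)`. -/
def ExMax {X Y : Type*} [Fintype X] [Fintype Y] (W : X → Y → ℝ) (ρ : ℝ) : EReal :=
  ⨆ Q ∈ stdSimplex ℝ X, Ex' W Q ρ

/-- Concave hull on `[1, ∞)`: the smallest concave function on `[1, ∞)` dominating `g`
there, as the pointwise infimum of all of them. -/
def concHull (g : ℝ → EReal) (x : ℝ) : EReal :=
  ⨅ h ∈ {h : ℝ → ℝ | ConcaveOn ℝ (Set.Ici (1 : ℝ)) h ∧ ∀ y, 1 ≤ y → g y ≤ (h y : EReal)},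
    (h x : EReal)

/-- The exponent `sup_{λ ≥ 1} {Ē'_x(λ) - t E_s(λ, P_V)}`, which may be `⊤`. -/
def exponent {V X Y : Type*} [Fintype V] [Fintype X] [Fintype Y]
    (PV : V → ℝ) (W : X → Y → ℝ) (t : ℝ) : EReal :=
  ⨆ lam ∈ Set.Ici (1 : ℝ), concHull (ExMax W) lam - ((t * Es PV lam : ℝ) : EReal)

/-- The objective of a source type `P`, as a function of the codeword distribution `Q`:
`sup_{ρ ≥ 1, λ > 0} [E'_x(Q, ρ) + (λ - ρ) t H(P) - t E_s(λ, P_V)]`. -/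
def typeObj {V X Y : Type*} [Fintype V] [Fintype X] [Fintype Y]
    (PV : V → ℝ) (W : X → Y → ℝ) (t : ℝ) (P : V → ℝ) (Q : X → ℝ) : EReal :=
  ⨆ ρ ∈ Set.Ici (1 : ℝ), ⨆ lam ∈ Set.Ioi (0 : ℝ),
    Ex' W Q ρ + (((lam - ρ) * (t * entH P) - t * Es PV lam : ℝ) : EReal)

/-- `Q` attains a finite maximum of the objective of `P` over all distributions on `X`. -/
def IsArgmax {V X Y : Type*} [Fintype V] [Fintype X] [Fintype Y]
    (PV : V → ℝ) (W : X → Y → ℝ) (t : ℝ) (P : V → ℝ) (Q : X → ℝ) : Prop :=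
  Q ∈ stdSimplex ℝ X ∧ IsMaxOn (typeObj PV W t P) (stdSimplex ℝ X) Q ∧ typeObj PV W t P Q ≠ ⊤

/-- The objective of `P` has a finite maximum that is attained. This holds for every
`P` if no two output distributions of the channel have disjoint supports and `P_V` has
full support. -/
def HasArgmax {V X Y : Type*} [Fintype V] [Fintype X] [Fintype Y]
    (PV : V → ℝ) (W : X → Y → ℝ) (t : ℝ) (P : V → ℝ) : Prop :=
  ∃ Q : X → ℝ, IsArgmax PV W t P Q

end

end JSCC

namespace JSCC

noncomputable section

open Filter Topology

/-- Bhattacharyya coefficient `∑_y √(W(y|x) W(y|x'))` of two inputs. -/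
def bhatt {X Y : Type*} [Fintype Y] (W : X → Y → ℝ) (x x' : X) : ℝ :=
  ∑ y, Real.sqrt (W x y * W x' y)

/-- The average `∑_{x'} Q'(x') e^{-d_B(x, x')/ρ}`. -/
def bhattAvg {X Y : Type*} [Fintype X] [Fintype Y] (W : X → Y → ℝ) (ρ : ℝ) (Q' : X → ℝ)
    (x : X) : ℝ :=
  ∑ x', Q' x' * bhatt W x x' ^ ρ⁻¹

lemma ereal_coe_sum {ι : Type*} (s : Finset ι) (g : ι → ℝ) :
    ((∑ i ∈ s, g i : ℝ) : EReal) = ∑ i ∈ s, (g i : EReal) :=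
  map_sum (⟨⟨Real.toEReal, EReal.coe_zero⟩, EReal.coe_add⟩ : ℝ →+ EReal) g s

section Bhattacharyya

variable {X Y : Type*} [Fintype Y] {W : X → Y → ℝ}

lemma bhatt_nonneg (x x' : X) : 0 ≤ bhatt W x x' :=
  Finset.sum_nonneg fun _ _ => Real.sqrt_nonneg _

lemma bhatt_comm (x x' : X) : bhatt W x x' = bhatt W x' x := by
  simp only [bhatt, mul_comm]

lemma bhatt_self (hW : IsDMC W) (x : X) : bhatt W x x = 1 := by
  rw [← (hW x).2]
  exact Finset.sum_congr rfl fun y _ => Real.sqrt_mul_self ((hW x).1 y)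

lemma bhatt_le_one (hW : IsDMC W) (x x' : X) : bhatt W x x' ≤ 1 := by
  have h : bhatt W x x' ≤ ∑ y, (W x y + W x' y) / 2 := by
    refine Finset.sum_le_sum fun y _ => ?_
    have h1 := (hW x).1 y
    have h2 := (hW x').1 y
    rw [Real.sqrt_le_left (by positivity)]
    nlinarith [sq_nonneg (W x y - W x' y)]
  rw [← Finset.sum_div, Finset.sum_add_distrib, (hW x).2, (hW x').2] at h
  linarith

variable [Fintype X]

lemma bhattAvg_nonneg {ρ : ℝ} {Q' : X → ℝ} (hQ' : Q' ∈ stdSimplex ℝ X) (x : X) :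
    0 ≤ bhattAvg W ρ Q' x :=
  Finset.sum_nonneg fun x' _ => mul_nonneg (hQ'.1 x') (Real.rpow_nonneg (bhatt_nonneg _ _) _)

lemma bhattAvg_le_one (hW : IsDMC W) {ρ : ℝ} (hρ : 0 < ρ) {Q' : X → ℝ}
    (hQ' : Q' ∈ stdSimplex ℝ X) (x : X) : bhattAvg W ρ Q' x ≤ 1 := by
  rw [← hQ'.2]
  refine Finset.sum_le_sum fun x' _ => mul_le_of_le_one_right (hQ'.1 x') ?_
  exact Real.rpow_le_one (bhatt_nonneg _ _) (bhatt_le_one hW _ _) (by positivity)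

lemma le_bhattAvg_self (hW : IsDMC W) {ρ : ℝ} {Q' : X → ℝ}
    (hQ' : Q' ∈ stdSimplex ℝ X) (x : X) : Q' x ≤ bhattAvg W ρ Q' x := by
  have h := Finset.single_le_sum (f := fun x' => Q' x' * bhatt W x x' ^ ρ⁻¹)
    (fun x' _ => mul_nonneg (hQ'.1 x') (Real.rpow_nonneg (bhatt_nonneg _ _) _))
    (Finset.mem_univ x)
  simpa [bhatt_self hW, bhattAvg] using h

lemma ennreal_bhattAvg {ρ : ℝ} (hρ : 0 < ρ) {Q' : X → ℝ} (hQ' : Q' ∈ stdSimplex ℝ X) (x : X) :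
    ∑ x', ENNReal.ofReal (Q' x') * EReal.exp (-(dB W x x') / (ρ : EReal)) =
      ENNReal.ofReal (bhattAvg W ρ Q' x) := by
  rw [bhattAvg, ENNReal.ofReal_sum_of_nonneg fun x' _ =>
    mul_nonneg (hQ'.1 x') (Real.rpow_nonneg (bhatt_nonneg _ _) _)]
  refine Finset.sum_congr rfl fun x' _ => ?_
  rw [ENNReal.ofReal_mul (hQ'.1 x'),
    ← ENNReal.ofReal_rpow_of_nonneg (bhatt_nonneg _ _) (by positivity)]
  congr 1
  rw [dB, neg_neg, EReal.div_eq_inv_mul, ← EReal.coe_inv, ← ENNReal.log_rpow, ENNReal.exp_log]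
  rfl

lemma ereal_bhattAvg_sum_of_pos {ρ : ℝ} (hρ : 0 < ρ) {Q Q' : X → ℝ}
    (hQ : Q ∈ stdSimplex ℝ X) (hQ' : Q' ∈ stdSimplex ℝ X)
    (hpos : ∀ x, 0 < Q x → 0 < bhattAvg W ρ Q' x) :
    -(ρ : EReal) * ∑ x, (Q x : EReal) *
      ENNReal.log (∑ x', ENNReal.ofReal (Q' x') * EReal.exp (-(dB W x x') / (ρ : EReal))) =
      ((-ρ * ∑ x, Q x * Real.log (bhattAvg W ρ Q' x) : ℝ) : EReal) := by
  rw [EReal.coe_mul, EReal.coe_neg]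
  congr 1
  rw [ereal_coe_sum]
  refine Finset.sum_congr rfl fun x _ => ?_
  rw [ennreal_bhattAvg hρ hQ']
  rcases (hQ.1 x).eq_or_lt with h | h
  · simp [← h]
  · rw [ENNReal.log_ofReal_of_pos (hpos x h), EReal.coe_mul]

lemma ereal_bhattAvg_sum_of_zero {ρ : ℝ} (hρ : 0 < ρ) {Q Q' : X → ℝ}
    (hQ' : Q' ∈ stdSimplex ℝ X) {x : X} (hx : 0 < Q x) (h0 : bhattAvg W ρ Q' x = 0) :
    -(ρ : EReal) * ∑ x, (Q x : EReal) *
      ENNReal.log (∑ x', ENNReal.ofReal (Q' x') * EReal.exp (-(dB W x x') / (ρ : EReal))) = ⊤ := by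
  have h : ∑ x, (Q x : EReal) * ENNReal.log
      (∑ x', ENNReal.ofReal (Q' x') * EReal.exp (-(dB W x x') / (ρ : EReal))) = ⊥ := by
    refine WithBot.sum_eq_bot_iff.2 ⟨x, Finset.mem_univ x, ?_⟩
    rw [ennreal_bhattAvg hρ hQ', h0, ENNReal.ofReal_zero, ENNReal.log_zero]
    exact EReal.coe_mul_bot_of_pos hx
  rw [h, ← EReal.coe_neg]
  exact EReal.coe_mul_bot_of_neg (by linarith)

/-- Lower bounds of the dual weak expurgated function, in real terms. -/
lemma coe_le_Ex'_iff {ρ : ℝ} (hρ : 0 < ρ) {Q : X → ℝ} (hQ : Q ∈ stdSimplex ℝ X) {e : ℝ} :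
    (e : EReal) ≤ Ex' W Q ρ ↔ ∀ Q' ∈ stdSimplex ℝ X, (∀ x, 0 < Q x → 0 < bhattAvg W ρ Q' x) →
      e ≤ -ρ * ∑ x, Q x * Real.log (bhattAvg W ρ Q' x) := by
  rw [Ex', le_iInf₂_iff]
  refine forall₂_congr fun Q' hQ' => ?_
  by_cases hpos : ∀ x, 0 < Q x → 0 < bhattAvg W ρ Q' x
  · rw [ereal_bhattAvg_sum_of_pos hρ hQ hQ' hpos, EReal.coe_le_coe_iff]
    exact ⟨fun h _ => h, fun h => h hpos⟩
  · have hpos' := hpos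
    push Not at hpos
    obtain ⟨x, hx, h0⟩ := hpos
    rw [ereal_bhattAvg_sum_of_zero hρ hQ' hx (le_antisymm h0 (bhattAvg_nonneg hQ' x))]
    exact ⟨fun _ h => absurd h hpos', fun _ => le_top⟩

lemma Ex'_nonneg (hW : IsDMC W) {ρ : ℝ} (hρ : 0 < ρ) {Q : X → ℝ} (hQ : Q ∈ stdSimplex ℝ X) :
    0 ≤ Ex' W Q ρ := by
  rw [← EReal.coe_zero, coe_le_Ex'_iff hρ hQ]
  intro Q' hQ' _
  rw [neg_mul, neg_nonneg]
  refine mul_nonpos_of_nonneg_of_nonpos hρ.le (Finset.sum_nonpos fun x _ => ?_)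
  exact mul_nonpos_of_nonneg_of_nonpos (hQ.1 x)
    (Real.log_nonpos (bhattAvg_nonneg hQ' x) (bhattAvg_le_one hW hρ hQ' x))

lemma Ex'_le (hW : IsDMC W) {ρ : ℝ} (hρ : 0 < ρ) {Q : X → ℝ} (hQ : Q ∈ stdSimplex ℝ X) :
    Ex' W Q ρ ≤ ((ρ * Real.log (Fintype.card X) : ℝ) : EReal) := by
  have hne : Nonempty X := by
    by_contra h
    rw [not_nonempty_iff] at h
    simpa using hQ.2
  have hcard : (0 : ℝ) < Fintype.card X := by exact_mod_cast Fintype.card_pos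
  refine EReal.ge_of_forall_gt_iff_ge.1 fun z hz => ?_
  set U : X → ℝ := fun _ => (Fintype.card X : ℝ)⁻¹ with hU
  have hUs : U ∈ stdSimplex ℝ X := ⟨fun _ => by positivity, by simp [hU, hcard.ne']⟩
  have hU1 : ∀ x, (Fintype.card X : ℝ)⁻¹ ≤ bhattAvg W ρ U x := fun x => le_bhattAvg_self hW hUs x
  have hUpos : ∀ x, 0 < bhattAvg W ρ U x := fun x => lt_of_lt_of_le (by positivity) (hU1 x)
  have h := (coe_le_Ex'_iff hρ hQ).1 hz.le U hUs fun x _ => hUpos x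
  refine EReal.coe_le_coe_iff.2 (h.trans ?_)
  rw [neg_mul, ← mul_neg]
  refine mul_le_mul_of_nonneg_left ?_ hρ.le
  rw [← Finset.sum_neg_distrib]
  calc ∑ x, -(Q x * Real.log (bhattAvg W ρ U x))
      ≤ ∑ x, Q x * Real.log (Fintype.card X) := by
        refine Finset.sum_le_sum fun x _ => ?_
        rw [← mul_neg]
        refine mul_le_mul_of_nonneg_left ?_ (hQ.1 x)
        have := Real.log_le_log (by positivity) (hU1 x)
        rw [Real.log_inv] at this
        linarith
    _ = _ := by rw [← Finset.sum_mul, hQ.2, one_mul]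

lemma Ex'_eq_coe (hW : IsDMC W) {ρ : ℝ} (hρ : 0 < ρ) {Q : X → ℝ} (hQ : Q ∈ stdSimplex ℝ X) :
    ∃ e : ℝ, Ex' W Q ρ = e ∧ 0 ≤ e ∧ e ≤ ρ * Real.log (Fintype.card X) := by
  have h0 := Ex'_nonneg hW hρ hQ
  have h1 := Ex'_le hW hρ hQ
  induction h : Ex' W Q ρ with
  | bot => simp [h] at h0
  | top => exact absurd (h ▸ h1) (not_le.2 (EReal.coe_lt_top _))
  | coe e =>
    rw [h] at h0 h1
    exact ⟨e, rfl, by exact_mod_cast h0, by exact_mod_cast h1⟩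

/-- Near-monotonicity of the dual weak expurgated function in the codeword distribution. -/
lemma le_Ex'_of_le (hW : IsDMC W) {ρ : ℝ} (hρ : 0 < ρ) {Q R : X → ℝ}
    (hQ : Q ∈ stdSimplex ℝ X) (hR : R ∈ stdSimplex ℝ X) {ε : ℝ} (hε : ε < 1)
    (hle : ∀ x, (1 - ε) * Q x ≤ R x) {e : ℝ} (he : (e : EReal) ≤ Ex' W Q ρ) :
    (((1 - ε) * e : ℝ) : EReal) ≤ Ex' W R ρ := by
  rw [coe_le_Ex'_iff hρ hR]
  intro Q' hQ' hpos
  have hpos' : ∀ x, 0 < Q x → 0 < bhattAvg W ρ Q' x := fun x hx =>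
    hpos x (lt_of_lt_of_le (mul_pos (by linarith) hx) (hle x))
  have h := (coe_le_Ex'_iff hρ hQ).1 he Q' hQ' hpos'
  refine (mul_le_mul_of_nonneg_left h (by linarith : 0 ≤ 1 - ε)).trans ?_
  rw [neg_mul, ← mul_neg, neg_mul, ← mul_neg, ← Finset.sum_neg_distrib, ← Finset.sum_neg_distrib,
    mul_left_comm]
  refine mul_le_mul_of_nonneg_left ?_ hρ.le
  rw [Finset.mul_sum]
  refine Finset.sum_le_sum fun x _ => ?_
  have := mul_le_mul_of_nonpos_right (hle x)
    (Real.log_nonpos (bhattAvg_nonneg hQ' x) (bhattAvg_le_one hW hρ hQ' x))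
  linarith

end Bhattacharyya

/-- The real value of the dual weak expurgated function. -/
def exReal {X Y : Type*} [Fintype X] [Fintype Y] (W : X → Y → ℝ) (Q : X → ℝ) (ρ : ℝ) : ℝ :=
  (Ex' W Q ρ).toReal

/-- The divergence `D(P ‖ P_V)` of a distribution `P` that is absolutely continuous with
respect to `P_V`. -/
def srcDiv {V : Type*} [Fintype V] (PV P : V → ℝ) : ℝ :=
  -entH P - ∑ v, P v * Real.log (PV v)

/-- The exponent guaranteed for the source type `P` by codewords of composition `Q`. -/
def typeExp {V X Y : Type*} [Fintype V] [Fintype X] [Fintype Y] (PV : V → ℝ) (W : X → Y → ℝ)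
    (t : ℝ) (P : V → ℝ) (Q : X → ℝ) (ρ : ℝ) : ℝ :=
  t * srcDiv PV P + exReal W Q ρ - ρ * (t * entH P)

section

variable {V X Y : Type*} [Fintype V] [Fintype X] [Fintype Y] {PV : V → ℝ} {W : X → Y → ℝ}

lemma coe_exReal (hW : IsDMC W) {ρ : ℝ} (hρ : 0 < ρ) {Q : X → ℝ} (hQ : Q ∈ stdSimplex ℝ X) :
    (exReal W Q ρ : EReal) = Ex' W Q ρ := by
  obtain ⟨e, he, -⟩ := Ex'_eq_coe hW hρ hQ
  rw [exReal, he, EReal.toReal_coe]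

lemma exReal_le (hW : IsDMC W) {ρ : ℝ} (hρ : 0 < ρ) {Q : X → ℝ} (hQ : Q ∈ stdSimplex ℝ X) :
    exReal W Q ρ ≤ ρ * Real.log (Fintype.card X) := by
  obtain ⟨e, he, -, h⟩ := Ex'_eq_coe hW hρ hQ
  rwa [exReal, he, EReal.toReal_coe]

lemma continuous_entH : Continuous (entH : (V → ℝ) → ℝ) := by
  unfold entH
  exact (continuous_finsetSum _ fun v _ =>
    Real.continuous_mul_log.comp (continuous_apply v)).neg

lemma continuous_srcDiv : Continuous (srcDiv PV) := by
  unfold srcDiv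
  exact continuous_entH.neg.sub
    (continuous_finsetSum _ fun v _ => (continuous_apply v).mul continuous_const)

lemma continuous_typeExp (t : ℝ) (Q : X → ℝ) (ρ : ℝ) :
    Continuous fun P => typeExp PV W t P Q ρ :=
  ((continuous_const.mul continuous_srcDiv).add continuous_const).sub
    (continuous_const.mul (continuous_const.mul continuous_entH))

lemma entH_nonneg {P : V → ℝ} (hP : P ∈ stdSimplex ℝ V) : 0 ≤ entH P := by
  rw [entH, neg_nonneg]
  refine Finset.sum_nonpos fun v _ => Real.mul_log_nonpos (hP.1 v) ?_
  rw [← hP.2]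
  exact Finset.single_le_sum (fun a _ => hP.1 a) (Finset.mem_univ v)

/-- Gibbs' variational inequality for Gallager's source function. -/
lemma entH_sub_Es_le_srcDiv (hPV : PV ∈ stdSimplex ℝ V) {P : V → ℝ} (hP : P ∈ stdSimplex ℝ V)
    (hac : ∀ v, PV v = 0 → P v = 0) {lam : ℝ} (hlam : 0 < lam) :
    lam * entH P - Es PV lam ≤ srcDiv PV P := by
  set s : ℝ := 1 / (1 + lam) with hs
  have hs0 : 0 < s := by positivity
  set Z : ℝ := ∑ v, PV v ^ s with hZ
  have hq : ∀ v, 0 ≤ PV v ^ s := fun v => Real.rpow_nonneg (hPV.1 v) _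
  have hZ0 : 0 < Z := by
    obtain ⟨v, hv⟩ : ∃ v, 0 < PV v := by
      by_contra h
      push Not at h
      have := hPV.2
      rw [Finset.sum_eq_zero fun v _ => le_antisymm (h v) (hPV.1 v)] at this
      exact zero_ne_one this
    exact Finset.sum_pos' (fun v _ => hq v) ⟨v, Finset.mem_univ v, Real.rpow_pos_of_pos hv _⟩
  have key : ∀ v, P v - PV v ^ s / Z ≤
      P v * Real.log (P v) - s * (P v * Real.log (PV v)) + P v * Real.log Z := by
    intro v
    rcases (hP.1 v).eq_or_lt with h | h
    · rw [← h]
      have := div_nonneg (hq v) hZ0.le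
      simp only [zero_mul, mul_zero]
      linarith
    · have hpv : 0 < PV v := lt_of_le_of_ne (hPV.1 v) fun h0 => h.ne' (hac v h0.symm)
      have hqv : 0 < PV v ^ s := Real.rpow_pos_of_pos hpv _
      have h1 := Real.log_le_sub_one_of_pos (div_pos (div_pos hqv hZ0) h)
      rw [Real.log_div (by positivity) h.ne', Real.log_div hqv.ne' hZ0.ne',
        Real.log_rpow hpv] at h1
      have h2 := mul_le_mul_of_nonneg_left h1 h.le
      have h3 : P v * (PV v ^ s / Z / P v - 1) = PV v ^ s / Z - P v := by field_simp
      rw [h3] at h2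
      linarith
  have hsum := Finset.sum_le_sum fun v (_ : v ∈ Finset.univ) => key v
  rw [Finset.sum_sub_distrib, ← Finset.sum_div, ← hZ, div_self hZ0.ne', hP.2,
    Finset.sum_add_distrib, Finset.sum_sub_distrib, ← Finset.mul_sum, ← Finset.sum_mul, hP.2] at hsum
  have hEs : Es PV lam = (1 + lam) * Real.log Z := rfl
  rw [hEs, srcDiv, entH]
  have h4 : (1 + lam) * s = 1 := by rw [hs]; field_simp
  have h5 := mul_le_mul_of_nonneg_left hsum (by linarith : 0 ≤ 1 + lam)
  linear_combination h5 - (∑ v, P v * Real.log (PV v)) * h4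

/-- Below the exponent, every source type has a codeword distribution whose objective is
uniformly large. -/
lemma exists_objective_of_lt_exponent {t E : ℝ} (hE : (E : EReal) < exponent PV W t) :
    ∃ E₂ : ℝ, E < E₂ ∧ ∃ lam : ℝ, 1 ≤ lam ∧ ∀ P : V → ℝ, ∃ Q ∈ stdSimplex ℝ X, ∃ ρ : ℝ, 1 ≤ ρ ∧
      (E₂ : EReal) <
        Ex' W Q ρ + (((lam - ρ) * (t * entH P) - t * Es PV lam : ℝ) : EReal) := by
  rw [exponent, lt_iSup_iff] at hE
  obtain ⟨lam, hE⟩ := hE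
  rw [lt_iSup_iff] at hE
  obtain ⟨hlam, hE⟩ := hE
  obtain ⟨E₂, h1, h2⟩ := EReal.lt_iff_exists_real_btwn.1 hE
  refine ⟨E₂, by exact_mod_cast h1, lam, hlam, fun P => ?_⟩
  by_contra! hcon
  refine absurd h2 (not_lt.2 ?_)
  rw [EReal.sub_le_iff_le_add (Or.inl (EReal.coe_ne_bot _)) (Or.inl (EReal.coe_ne_top _)),
    ← EReal.coe_add]
  set h : ℝ → ℝ := fun ρ => (t * entH P) * ρ + (E₂ + t * Es PV lam - lam * (t * entH P)) with hh
  have hmem : h ∈ {h : ℝ → ℝ | ConcaveOn ℝ (Set.Ici (1 : ℝ)) h ∧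
      ∀ y, 1 ≤ y → ExMax W y ≤ (h y : EReal)} := by
    refine ⟨⟨convex_Ici 1, fun x _ y _ a b _ _ hab => ?_⟩, fun ρ hρ => ?_⟩
    · simp only [hh, smul_eq_mul]
      exact le_of_eq (by linear_combination (E₂ + t * Es PV lam - lam * (t * entH P)) * hab)
    · refine iSup₂_le fun Q hQ => ?_
      have := hcon Q hQ ρ hρ
      rw [← EReal.le_sub_iff_add_le (Or.inl (EReal.coe_ne_bot _)) (Or.inl (EReal.coe_ne_top _)),
        ← EReal.coe_sub] at this
      refine this.trans (EReal.coe_le_coe_iff.2 (le_of_eq ?_))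
      simp only [hh]
      ring
  refine (iInf₂_le h hmem).trans (EReal.coe_le_coe_iff.2 (le_of_eq ?_))
  simp only [hh]
  ring

lemma lt_typeExp_of_lt_objective (hPV : PV ∈ stdSimplex ℝ V) (hW : IsDMC W) {t : ℝ} (ht : 0 < t)
    {P : V → ℝ} (hP : P ∈ stdSimplex ℝ V) (hac : ∀ v, PV v = 0 → P v = 0) {Q : X → ℝ}
    (hQ : Q ∈ stdSimplex ℝ X) {ρ lam E : ℝ} (hρ : 1 ≤ ρ) (hlam : 0 < lam)
    (h : (E : EReal) < Ex' W Q ρ + (((lam - ρ) * (t * entH P) - t * Es PV lam : ℝ) : EReal)) :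
    E < typeExp PV W t P Q ρ := by
  rw [← coe_exReal hW (by linarith) hQ, ← EReal.coe_add, EReal.coe_lt_coe_iff] at h
  have := mul_le_mul_of_nonneg_left (entH_sub_Es_le_srcDiv hPV hP hac hlam) ht.le
  rw [typeExp]
  linarith

lemma lt_typeExp_argmax (hPV : PV ∈ stdSimplex ℝ V) (hW : IsDMC W) {t : ℝ} (ht : 0 < t)
    {P : V → ℝ} (hP : P ∈ stdSimplex ℝ V) (hac : ∀ v, PV v = 0 → P v = 0) {Q Q₀ : X → ℝ}
    (hQ : Q ∈ stdSimplex ℝ X) (hQ₀ : IsArgmax PV W t P Q₀) {ρ lam E : ℝ} (hρ : 1 ≤ ρ)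
    (hlam : 0 < lam)
    (h : (E : EReal) < Ex' W Q ρ + (((lam - ρ) * (t * entH P) - t * Es PV lam : ℝ) : EReal)) :
    ∃ ρ₀ : ℝ, 1 ≤ ρ₀ ∧ E < typeExp PV W t P Q₀ ρ₀ := by
  have h1 : (E : EReal) < typeObj PV W t P Q₀ := by
    refine (h.trans_le ?_).trans_le (hQ₀.2.1 hQ)
    exact le_iSup₂_of_le ρ hρ (le_iSup₂_of_le lam hlam le_rfl)
  rw [typeObj, lt_iSup_iff] at h1
  obtain ⟨ρ₀, h1⟩ := h1
  rw [lt_iSup_iff] at h1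
  obtain ⟨hρ₀, h1⟩ := h1
  rw [lt_iSup_iff] at h1
  obtain ⟨lam₀, h1⟩ := h1
  rw [lt_iSup_iff] at h1
  obtain ⟨hlam₀, h1⟩ := h1
  exact ⟨ρ₀, hρ₀, lt_typeExp_of_lt_objective hPV hW ht hP hac hQ₀.1 hρ₀ hlam₀ h1⟩

lemma exists_exReal_le_of_hasArgmax (hW : IsDMC W) {t : ℝ} {P : V → ℝ}
    (h : HasArgmax PV W t P) :
    ∃ C : ℝ, ∀ Q ∈ stdSimplex ℝ X, ∀ ρ : ℝ, 1 ≤ ρ → exReal W Q ρ ≤ C + ρ * (t * entH P) := by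
  obtain ⟨Q₀, -, hmax, htop⟩ := h
  refine ⟨(typeObj PV W t P Q₀).toReal - t * entH P + t * Es PV 1, fun Q hQ ρ hρ => ?_⟩
  have h1 : Ex' W Q ρ + (((1 - ρ) * (t * entH P) - t * Es PV 1 : ℝ) : EReal) ≤
      typeObj PV W t P Q₀ := by
    refine le_trans ?_ (hmax hQ)
    exact le_iSup₂_of_le ρ hρ (le_iSup₂_of_le (1 : ℝ) (Set.mem_Ioi.2 one_pos) le_rfl)
  have h2 := h1.trans (EReal.le_coe_toReal htop)
  rw [← coe_exReal hW (by linarith) hQ, ← EReal.coe_add, EReal.coe_le_coe_iff] at h2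
  linarith

/-- Below the exponent, the codeword distributions can be chosen close to the given maximizers
such that the parameter `ρ` stays bounded uniformly over all source types. -/
lemma exists_bounded_parameter [Nonempty X] (hPV : PV ∈ stdSimplex ℝ V) (hW : IsDMC W)
    {t : ℝ} (ht : 0 < t) {Qi : (V → ℝ) → X → ℝ}
    (hQi : ∀ P ∈ stdSimplex ℝ V, HasArgmax PV W t P → IsArgmax PV W t P (Qi P))
    {E : ℝ} (hE : (E : EReal) < exponent PV W t) {δ : ℝ} (hδ : 0 < δ) :
    ∃ E₁ : ℝ, E < E₁ ∧ ∃ ρb : ℝ, 1 ≤ ρb ∧ ∀ P ∈ stdSimplex ℝ V, (∀ v, PV v = 0 → P v = 0) →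
      ∃ Q ∈ stdSimplex ℝ X, ∃ ρ : ℝ, 1 ≤ ρ ∧ ρ ≤ ρb ∧ E₁ ≤ typeExp PV W t P Q ρ ∧
        (HasArgmax PV W t P → ∀ x, |Q x - Qi P x| ≤ δ) := by
  classical
  obtain ⟨E₂, hE₂, lam, hlam, hobj⟩ := exists_objective_of_lt_exponent hE
  obtain ⟨E₁, hE₁, hE₁₂⟩ := exists_between hE₂
  refine ⟨E₁, hE₁, ?_⟩
  by_contra! hcon
  set K : Set (V → ℝ) := stdSimplex ℝ V ∩ {P | ∀ v, PV v = 0 → P v = 0} with hK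
  have hKc : IsCompact K := by
    refine (isCompact_stdSimplex ℝ V).inter_right ?_
    simp only [Set.ofPred_forall]
    exact isClosed_iInter fun v => isClosed_iInter fun _ =>
      isClosed_eq (continuous_apply v) continuous_const
  choose Ps hPs hPac hPbad using fun m : ℕ => hcon (m + 1) (by linarith [m.cast_nonneg (α := ℝ)])
  obtain ⟨q₀, hq₀⟩ : (stdSimplex ℝ X).Nonempty := ⟨_, single_mem_stdSimplex ℝ (Classical.arbitrary X)⟩
  set Qs : ℕ → X → ℝ := fun m => if HasArgmax PV W t (Ps m) then Qi (Ps m) else q₀ with hQs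
  have hQsmem : ∀ m, Qs m ∈ stdSimplex ℝ X := by
    intro m
    simp only [hQs]
    split_ifs with h
    exacts [(hQi _ (hPs m) h).1, hq₀]
  obtain ⟨⟨P', Q'⟩, ⟨hP', hQ'⟩, φ, hφ, hlim⟩ :=
    (hKc.prod (isCompact_stdSimplex ℝ X)).tendsto_subseq
      (x := fun m => (Ps m, Qs m)) fun m => ⟨⟨hPs m, hPac m⟩, hQsmem m⟩
  set p : ℕ → V → ℝ := fun m => Ps (φ m) with hp
  set q : ℕ → X → ℝ := fun m => Qs (φ m) with hq
  have hpl : Tendsto p atTop (𝓝 P') := (continuous_fst.tendsto _).comp hlim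
  have hql : Tendsto q atTop (𝓝 Q') := (continuous_snd.tendsto _).comp hlim
  have hbad : ∀ m : ℕ, ∀ Q ∈ stdSimplex ℝ X, ∀ ρ : ℝ, 1 ≤ ρ → ρ ≤ m →
      E₁ ≤ typeExp PV W t (p m) Q ρ →
      HasArgmax PV W t (p m) ∧ ∃ x, δ < |Q x - Qi (p m) x| := by
    intro m Q hQ ρ h1 h2 h3
    have : (m : ℝ) ≤ φ m := by exact_mod_cast hφ.id_le m
    exact hPbad (φ m) Q hQ ρ h1 (by linarith) h3
  have hlarge : ∀ C : ℝ, ∀ᶠ m : ℕ in atTop, C ≤ m := fun C =>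
    tendsto_natCast_atTop_atTop.eventually_ge_atTop C
  have hreg : ∀ᶠ m in atTop, HasArgmax PV W t (p m) := by
    obtain ⟨Q, hQ, ρ, hρ, h⟩ := hobj P'
    have h1 := lt_typeExp_of_lt_objective hPV hW ht hP'.1 hP'.2 hQ hρ (by linarith) h
    have h2 := ((continuous_typeExp (PV := PV) (W := W) t Q ρ).tendsto P').comp hpl
    filter_upwards [h2.eventually_const_le (hE₁₂.trans h1), hlarge ρ] with m hm hm'
    exact (hbad m Q hQ ρ hρ hm' hm).1
  have hqi : ∀ m, HasArgmax PV W t (p m) → q m = Qi (p m) := fun m hm => by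
    simp only [hq, hQs]
    exact if_pos hm
  have hpar : ∀ m, HasArgmax PV W t (p m) → ∃ ρ : ℝ, 1 ≤ ρ ∧ E₂ < typeExp PV W t (p m) (q m) ρ := by
    intro m hm
    obtain ⟨Q, hQ, ρ, hρ, h⟩ := hobj (p m)
    rw [hqi m hm]
    exact lt_typeExp_argmax hPV hW ht (hPs _) (hPac _) hQ (hQi _ (hPs _) hm) hρ (by linarith) h
  have hHl : Tendsto (fun m => entH (p m)) atTop (𝓝 (entH P')) :=
    (continuous_entH.tendsto P').comp hpl
  have hDl : Tendsto (fun m => t * srcDiv PV (p m)) atTop (𝓝 (t * srcDiv PV P')) :=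
    (((continuous_const.mul continuous_srcDiv).tendsto P').comp hpl)
  have hqclose : ∀ᶠ m in atTop, ∀ x, |q m x - Q' x| ≤ δ / 2 := by
    rw [eventually_all]
    intro x
    have h1 : Tendsto (fun m => q m x) atTop (𝓝 (Q' x)) := ((continuous_apply x).tendsto _).comp hql
    filter_upwards [Metric.tendsto_nhds.1 h1 (δ / 2) (by linarith)] with m hm
    rw [Real.dist_eq] at hm
    exact hm.le
  by_cases hfreq : ∃ᶠ m in atTop, entH P' ≤ entH (p m)
  · have hD : ∀ᶠ m in atTop, t * srcDiv PV (p m) ≤ t * srcDiv PV P' + (E₂ - E₁) / 2 :=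
      hDl.eventually_le_const (by linarith)
    obtain ⟨m₀, hH, ⟨hr, hD⟩, hc⟩ := (hfreq.and_eventually ((hreg.and hD).and hqclose)).exists
    obtain ⟨ρ, hρ, hval⟩ := hpar m₀ hr
    have h1 : E₁ < typeExp PV W t P' (q m₀) ρ := by
      have := mul_le_mul_of_nonneg_left hH (mul_nonneg (by linarith : (0 : ℝ) ≤ ρ) ht.le)
      simp only [typeExp] at hval ⊢
      linarith
    have h2 := ((continuous_typeExp (PV := PV) (W := W) t (q m₀) ρ).tendsto P').comp hpl
    obtain ⟨m, ⟨⟨hm1, hm2⟩, hm3⟩, hm4⟩ := (((h2.eventually_const_le h1).and (hlarge ρ)).and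
      hqclose |>.and hreg).exists
    obtain ⟨-, x, hx⟩ := hbad m (q m₀) (hQsmem _) ρ hρ hm2 hm1
    rw [← hqi m hm4] at hx
    have := abs_sub_le (q m₀ x) (Q' x) (q m x)
    have h3 := hm3 x
    rw [abs_sub_comm] at h3
    linarith [hc x]
  · rw [not_frequently] at hfreq
    obtain ⟨m₁, hr₁, hH₁⟩ := (hreg.and hfreq).exists
    rw [not_le] at hH₁
    obtain ⟨C, hC⟩ := exists_exReal_le_of_hasArgmax hW hr₁
    set η : ℝ := (entH P' - entH (p m₁)) / 2 with hη
    have hη0 : 0 < η := by linarith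
    obtain ⟨m, ⟨⟨hm1, hm2⟩, hm3⟩, hm4⟩ := (((hHl.eventually_const_le
      (by linarith : entH (p m₁) + η < entH P')).and (hDl.eventually_le_const
      (by linarith : t * srcDiv PV P' < t * srcDiv PV P' + 1))).and hreg |>.and
      (hlarge ((t * srcDiv PV P' + 1 + C - E₂) / (t * η)))).exists
    obtain ⟨ρ, hρ, hval⟩ := hpar m hm3
    have hρm : ρ ≤ m := by
      refine le_trans ?_ hm4
      rw [le_div_iff₀ (by positivity)]
      have h1 := hC (q m) (hQsmem _) ρ hρ
      have h2 := mul_le_mul_of_nonneg_left hm1 (mul_nonneg (by linarith : (0 : ℝ) ≤ ρ) ht.le)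
      simp only [typeExp] at hval
      linarith
    obtain ⟨-, x, hx⟩ := hbad m (q m) (hQsmem _) ρ hρ hρm (by linarith)
    rw [← hqi m hm3, sub_self, abs_zero] at hx
    linarith

end

open scoped Classical in
/-- The number of occurrences of a letter in a sequence. -/
def symCount {α : Type*} {n : ℕ} (x : Fin n → α) (a : α) : ℕ :=
  (Finset.univ.filter fun i => x i = a).card

open scoped Classical in
/-- The sequences with the same letter counts as a given one. -/
def countClass {α : Type*} [Fintype α] {n : ℕ} (x : Fin n → α) : Finset (Fin n → α) :=
  Finset.univ.filter fun x' => symCount x' = symCount x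

section

variable {α : Type*} {n : ℕ}

lemma empDist_apply (x : Fin n → α) (a : α) : empDist x a = (symCount x a : ℝ) / n := rfl

lemma symCount_le (x : Fin n → α) (a : α) : symCount x a ≤ n := by
  classical
  simpa [symCount] using Finset.card_le_univ (Finset.univ.filter fun i => x i = a)

lemma natCast_mul_empDist (x : Fin n → α) (a : α) : (n : ℝ) * empDist x a = symCount x a := by
  rcases n.eq_zero_or_pos with rfl | hn
  · simp [symCount]
  · rw [empDist_apply]
    field_simp

lemma symCount_eq_of_empDist_eq {x x' : Fin n → α} (h : empDist x = empDist x') :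
    symCount x = symCount x' := by
  funext a
  have := natCast_mul_empDist x a
  rw [h, natCast_mul_empDist] at this
  exact_mod_cast this.symm

lemma empDist_eq_iff {x x' : Fin n → α} : empDist x = empDist x' ↔ symCount x = symCount x' := by
  refine ⟨symCount_eq_of_empDist_eq, fun h => ?_⟩
  funext a
  rw [empDist_apply, empDist_apply, h]

lemma symCount_comp_perm (x : Fin n → α) (σ : Equiv.Perm (Fin n)) :
    symCount (x ∘ σ) = symCount x := by
  classical
  funext a
  exact Finset.card_bij (fun i _ => σ i) (by simp) (by simp)
    fun j hj => ⟨σ.symm j, by simpa using hj, by simp⟩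

lemma exists_perm_of_symCount_eq {x x' : Fin n → α} (h : symCount x = symCount x') :
    ∃ σ : Equiv.Perm (Fin n), x' = x ∘ σ := by
  classical
  have e : ∀ a, Fintype.card {i // x' i = a} = Fintype.card {i // x i = a} := by
    intro a
    rw [Fintype.card_subtype, Fintype.card_subtype]
    have := congrFun h a
    simp only [symCount] at this
    convert this.symm
  refine ⟨(Equiv.sigmaFiberEquiv x').symm.trans ((Equiv.sigmaCongrRight
    fun a => Fintype.equivOfCardEq (e a)).trans (Equiv.sigmaFiberEquiv x)), ?_⟩
  funext i
  simp only [Function.comp_apply, Equiv.trans_apply]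
  generalize hs : (Equiv.sigmaCongrRight _) _ = s
  have h1 : s.1 = x' i := by rw [← hs]; rfl
  rw [← h1]
  exact s.2.2.symm

variable [Fintype α]

lemma mem_countClass {x x' : Fin n → α} : x' ∈ countClass x ↔ symCount x' = symCount x := by
  classical
  simp [countClass]

lemma self_mem_countClass (x : Fin n → α) : x ∈ countClass x := mem_countClass.2 rfl

lemma sum_symCount (x : Fin n → α) : ∑ a, symCount x a = n := by
  classical
  have := Finset.card_eq_sum_card_fiberwise (s := (Finset.univ : Finset (Fin n))) (f := x)
    (t := Finset.univ) (by simp)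
  rw [Finset.card_univ, Fintype.card_fin] at this
  exact this.symm

lemma empDist_mem_stdSimplex (hn : n ≠ 0) (x : Fin n → α) : empDist x ∈ stdSimplex ℝ α := by
  refine ⟨fun a => div_nonneg (Nat.cast_nonneg _) (Nat.cast_nonneg _), ?_⟩
  simp only [empDist_apply]
  rw [← Finset.sum_div, ← Nat.cast_sum, sum_symCount]
  exact div_self (Nat.cast_ne_zero.2 hn)

lemma prod_comp_eq_prod_pow (g : α → ℝ) (x : Fin n → α) :
    ∏ i, g (x i) = ∏ a, g a ^ symCount x a := by
  classical
  rw [← Finset.prod_fiberwise' Finset.univ x g]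
  refine Finset.prod_congr rfl fun a _ => ?_
  rw [Finset.prod_const, symCount]

lemma prod_comp_eq_exp {g : α → ℝ} (x : Fin n → α) (hg : ∀ a, 0 < empDist x a → 0 < g a) :
    ∏ i, g (x i) = Real.exp (n * ∑ a, empDist x a * Real.log (g a)) := by
  rw [prod_comp_eq_prod_pow, Finset.mul_sum, Real.exp_sum]
  refine Finset.prod_congr rfl fun a _ => ?_
  rw [← mul_assoc, natCast_mul_empDist]
  rcases Nat.eq_zero_or_pos (symCount x a) with h | h
  · simp [h]
  · have hn : 0 < n := lt_of_lt_of_le h (symCount_le x a)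
    have h1 : 0 < g a := hg a (by rw [empDist_apply]; positivity)
    rw [mul_comm, Real.exp_mul, Real.exp_log h1, Real.rpow_natCast]

lemma prodDist_empDist (x : Fin n → α) :
    prodDist (empDist x) x = Real.exp (-(n * entH (empDist x))) := by
  rw [prodDist, prod_comp_eq_exp x fun a h => h, entH, mul_neg, neg_neg]

lemma sum_prodDist {P : α → ℝ} (hP : P ∈ stdSimplex ℝ α) :
    ∑ x : Fin n → α, prodDist P x = 1 := by
  classical
  simp only [prodDist]
  rw [← Fintype.piFinset_univ, ← Finset.prod_univ_sum]
  simp [hP.2]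

lemma prodDist_nonneg {P : α → ℝ} (hP : P ∈ stdSimplex ℝ α) (x : Fin n → α) :
    0 ≤ prodDist P x :=
  Finset.prod_nonneg fun _ _ => hP.1 _

lemma prodDist_eq_of_symCount_eq (P : α → ℝ) {x x' : Fin n → α} (h : symCount x = symCount x') :
    prodDist P x = prodDist P x' := by
  rw [prodDist, prodDist, prod_comp_eq_prod_pow, prod_comp_eq_prod_pow, h]

lemma card_countClass_le (hn : n ≠ 0) (x : Fin n → α) :
    ((countClass x).card : ℝ) ≤ Real.exp (n * entH (empDist x)) := by
  have h : ((countClass x).card : ℝ) * prodDist (empDist x) x ≤ 1 := by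
    rw [← sum_prodDist (n := n) (empDist_mem_stdSimplex hn x), ← nsmul_eq_mul, ← Finset.sum_const]
    refine (Finset.sum_le_sum fun x' hx' => ?_).trans (Finset.sum_le_sum_of_subset_of_nonneg
      (Finset.subset_univ (countClass x)) fun x' _ _ =>
        prodDist_nonneg (empDist_mem_stdSimplex hn x) x')
    rw [prodDist_eq_of_symCount_eq _ (mem_countClass.1 hx')]
  rw [prodDist_empDist, Real.exp_neg, ← div_eq_mul_inv, div_le_one (Real.exp_pos _)] at h
  exact h

lemma factorial_le_card_countClass (x : Fin n → α) :
    n.factorial ≤ (countClass x).card * ∏ a, (symCount x a).factorial := by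
  classical
  have h1 : (Finset.univ : Finset (Equiv.Perm (Fin n))).card = n.factorial := by
    rw [Finset.card_univ, Fintype.card_perm, Fintype.card_fin]
  rw [← h1, mul_comm]
  refine Finset.card_le_mul_card_image_of_maps_to (f := fun σ : Equiv.Perm (Fin n) => x ∘ σ)
    (fun σ _ => mem_countClass.2 (symCount_comp_perm x σ)) _ fun x' hx' => ?_
  have h2 := DomMulAct.stabilizer_card x
  have h3 : ∏ a, (symCount x a).factorial = ∏ a, (Fintype.card {i // x i = a}).factorial := by
    refine Finset.prod_congr rfl fun a _ => ?_
    rw [Fintype.card_subtype, symCount]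
  rw [h3, ← h2, Fintype.card_subtype]
  obtain ⟨τ, rfl⟩ := exists_perm_of_symCount_eq (mem_countClass.1 hx').symm
  refine Finset.card_le_card_of_injOn (fun σ => σ * τ⁻¹) (fun σ hσ => ?_) (fun a _ b _ h => by
    simpa using h)
  simp only [Finset.coe_filter, Finset.mem_univ, true_and, Set.mem_ofPred_eq] at hσ ⊢
  funext i
  have := congrFun hσ (τ⁻¹ i)
  simpa using this

end

lemma factorial_mul_exp_le (c : ℕ) :
    (c.factorial : ℝ) * Real.exp c ≤ Real.exp 1 * (c + 1) * (c : ℝ) ^ c := by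
  rcases Nat.eq_zero_or_pos c with rfl | hc
  · simp
  suffices h : (c.factorial : ℝ) * Real.exp c ≤ Real.exp 1 * c * (c : ℝ) ^ c by
    refine h.trans ?_
    gcongr
    linarith
  induction c, hc using Nat.le_induction with
  | base => simp
  | succ c hc ih =>
    have hc' : (0 : ℝ) < c := by exact_mod_cast hc
    have h1 : Real.exp 1 * (c : ℝ) ^ (c + 1) ≤ ((c : ℝ) + 1) ^ (c + 1) := by
      have h2 : (c : ℝ) / (c + 1) ≤ Real.exp (-(1 / (c + 1))) := by
        have := Real.add_one_le_exp (-(1 / ((c : ℝ) + 1)))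
        refine le_trans (le_of_eq ?_) this
        field_simp
        ring
      have h3 := pow_le_pow_left₀ (by positivity) h2 (c + 1)
      rw [← Real.exp_nat_mul, div_pow, div_le_iff₀ (by positivity)] at h3
      have h4 : ((c + 1 : ℕ) : ℝ) * -(1 / ((c : ℝ) + 1)) = -1 := by
        push_cast
        field_simp
      rw [h4] at h3
      have h5 := mul_le_mul_of_nonneg_left h3 (Real.exp_pos 1).le
      rwa [← mul_assoc, ← Real.exp_add, add_neg_cancel, Real.exp_zero, one_mul] at h5
    rw [Nat.factorial_succ]
    push_cast
    rw [Real.exp_add]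
    calc ((c : ℝ) + 1) * c.factorial * (Real.exp c * Real.exp 1)
        = ((c : ℝ) + 1) * Real.exp 1 * (c.factorial * Real.exp c) := by ring
      _ ≤ ((c : ℝ) + 1) * Real.exp 1 * (Real.exp 1 * c * (c : ℝ) ^ c) := by gcongr
      _ = Real.exp 1 * (c + 1) * (Real.exp 1 * (c : ℝ) ^ (c + 1)) := by ring
      _ ≤ Real.exp 1 * (c + 1) * ((c : ℝ) + 1) ^ (c + 1) := by gcongr

section

variable {α : Type*} {n : ℕ} [Fintype α]

/-- A type class carries at least a polynomial fraction of the mass of its own distribution. -/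
lemma one_le_card_countClass_mul_prodDist (hn : n ≠ 0) (x : Fin n → α) :
    1 ≤ (Real.exp 1 * (n + 1)) ^ Fintype.card α *
      ((countClass x).card * prodDist (empDist x) x) := by
  have hn' : (0 : ℝ) < n := by positivity
  have h1 : (n.factorial : ℝ) ≤ (countClass x).card * ∏ a, ((symCount x a).factorial : ℝ) := by
    exact_mod_cast factorial_le_card_countClass x
  have h2 : (n : ℝ) ^ n ≤ n.factorial * Real.exp n := by
    have := Real.pow_div_factorial_le_exp (n : ℝ) hn'.le n
    rwa [div_le_iff₀ (by positivity), mul_comm] at this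
  have h3 : (∏ a, ((symCount x a).factorial : ℝ)) * Real.exp n ≤
      (Real.exp 1 * (n + 1)) ^ Fintype.card α * ∏ a, (symCount x a : ℝ) ^ symCount x a := by
    have h4 : Real.exp n = ∏ a, Real.exp (symCount x a) := by
      rw [← Real.exp_sum, ← Nat.cast_sum, sum_symCount]
    have h5 : (Real.exp 1 * ((n : ℝ) + 1)) ^ Fintype.card α =
        ∏ _a : α, (Real.exp 1 * ((n : ℝ) + 1)) := by
      rw [Finset.prod_const, Finset.card_univ]
    rw [h4, h5, ← Finset.prod_mul_distrib, ← Finset.prod_mul_distrib]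
    refine Finset.prod_le_prod (fun a _ => by positivity) fun a _ => ?_
    refine (factorial_mul_exp_le _).trans ?_
    have : (symCount x a : ℝ) ≤ n := by exact_mod_cast symCount_le x a
    gcongr
  have h6 : prodDist (empDist x) x * (n : ℝ) ^ n = ∏ a, (symCount x a : ℝ) ^ symCount x a := by
    have h7 : (n : ℝ) ^ n = ∏ a, (n : ℝ) ^ symCount x a := by
      rw [Finset.prod_pow_eq_pow_sum, sum_symCount]
    rw [prodDist, prod_comp_eq_prod_pow, h7, ← Finset.prod_mul_distrib]
    refine Finset.prod_congr rfl fun a _ => ?_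
    rw [← mul_pow, mul_comm, natCast_mul_empDist]
  have hpos : 0 < (n : ℝ) ^ n := by positivity
  refine le_of_mul_le_mul_right ?_ hpos
  calc 1 * (n : ℝ) ^ n ≤ n.factorial * Real.exp n := by rw [one_mul]; exact h2
    _ ≤ (countClass x).card * (∏ a, ((symCount x a).factorial : ℝ)) * Real.exp n := by gcongr
    _ = (countClass x).card * ((∏ a, ((symCount x a).factorial : ℝ)) * Real.exp n) := by ring
    _ ≤ (countClass x).card * ((Real.exp 1 * (n + 1)) ^ Fintype.card α *
          ∏ a, (symCount x a : ℝ) ^ symCount x a) := by gcongr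
    _ = _ := by rw [← h6]; ring

lemma exists_symCount_eq (c : α → ℕ) (hc : ∑ a, c a = n) : ∃ x : Fin n → α, symCount x = c := by
  classical
  have e : Fin n ≃ Σ a, Fin (c a) := Fintype.equivOfCardEq (by simp [hc])
  refine ⟨fun i => (e i).1, ?_⟩
  funext a
  rw [symCount]
  have h : (Finset.univ.filter fun i => (e i).1 = a).card =
      (Finset.univ.filter fun s : Σ a, Fin (c a) => s.1 = a).card :=
    Finset.card_bij (fun i _ => e i) (by simp) (by simp)
      fun s hs => ⟨e.symm s, by simpa using hs, by simp⟩
  have h2 : (Finset.univ.filter fun s : Σ a, Fin (c a) => s.1 = a) =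
      Finset.univ.map (Function.Embedding.sigmaMk (β := fun a => Fin (c a)) a) := by
    ext ⟨b, j⟩
    simp only [Finset.mem_filter, Finset.mem_univ, true_and, Finset.mem_map,
      Function.Embedding.sigmaMk_apply]
    constructor
    · rintro rfl
      exact ⟨j, rfl⟩
    · rintro ⟨j', h'⟩
      exact (congrArg Sigma.fst h').symm
  rw [h2, Finset.card_map, Finset.card_univ, Fintype.card_fin] at h
  convert h

/-- Approximation of a distribution by a type that nearly dominates it. -/
lemma exists_empDist_near {Q : α → ℝ} (hQ : Q ∈ stdSimplex ℝ α)
    (hn : Fintype.card α ^ 2 ≤ n) :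
    ∃ x : Fin n → α, ∀ a, (1 - (Fintype.card α : ℝ) ^ 2 / n) * Q a ≤ empDist x a ∧
      |empDist x a - Q a| ≤ (Fintype.card α : ℝ) / n := by
  classical
  set m : ℝ := (Fintype.card α : ℝ) with hm
  have hne : Nonempty α := by
    by_contra h
    rw [not_nonempty_iff] at h
    simpa using hQ.2
  have hcard : 0 < Fintype.card α := Fintype.card_pos
  have hm0 : 0 < m := Nat.cast_pos.2 hcard
  have hm1 : 1 ≤ m := Nat.one_le_cast.2 hcard
  have hn0 : 0 < n := lt_of_lt_of_le (by positivity) hn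
  have hn' : (0 : ℝ) < n := by exact_mod_cast hn0
  have hnm : m ^ 2 ≤ n := by rw [hm]; exact_mod_cast hn
  obtain ⟨a₀, -, ha₀⟩ := Finset.exists_max_image (Finset.univ : Finset α) Q Finset.univ_nonempty
  have hbig : 1 ≤ m * Q a₀ := by
    rw [← hQ.2]
    refine (Finset.sum_le_card_nsmul _ _ _ fun a ha => ha₀ a ha).trans (le_of_eq ?_)
    rw [nsmul_eq_mul, Finset.card_univ]
  set s : Finset α := Finset.univ.erase a₀ with hs
  have hsum : Q a₀ + ∑ a ∈ s, Q a = 1 := by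
    rw [hs, Finset.add_sum_erase _ _ (Finset.mem_univ a₀)]
    exact hQ.2
  set u : α → ℕ := fun a => ⌈(n : ℝ) * Q a⌉₊ with hu
  have hu1 : ∀ a, (n : ℝ) * Q a ≤ u a := fun a => Nat.le_ceil _
  have hu2 : ∀ a, (u a : ℝ) ≤ n * Q a + 1 := fun a =>
    (Nat.ceil_lt_add_one (mul_nonneg hn'.le (hQ.1 a))).le
  have hscard : (s.card : ℝ) ≤ m := by
    rw [hm]
    exact_mod_cast Finset.card_le_univ s
  have hU1 : (n : ℝ) * (1 - Q a₀) ≤ ∑ a ∈ s, (u a : ℝ) := by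
    have : 1 - Q a₀ = ∑ a ∈ s, Q a := by linarith
    rw [this, Finset.mul_sum]
    exact Finset.sum_le_sum fun a _ => hu1 a
  have hU2 : ∑ a ∈ s, (u a : ℝ) ≤ n * (1 - Q a₀) + m := by
    have : 1 - Q a₀ = ∑ a ∈ s, Q a := by linarith
    rw [this, Finset.mul_sum]
    refine (Finset.sum_le_sum fun a _ => hu2 a).trans ?_
    rw [Finset.sum_add_distrib, Finset.sum_const, nsmul_eq_mul, mul_one]
    linarith
  have hQn : m ≤ n * Q a₀ := by
    have : m * 1 ≤ m * (m * (Q a₀)) := mul_le_mul_of_nonneg_left hbig hm0.le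
    nlinarith [mul_le_mul_of_nonneg_right hnm (hQ.1 a₀)]
  have hUn : ∑ a ∈ s, u a ≤ n := by
    have : ((∑ a ∈ s, u a : ℕ) : ℝ) ≤ n := by
      push_cast
      linarith
    exact_mod_cast this
  set c : α → ℕ := Function.update u a₀ (n - ∑ a ∈ s, u a) with hc
  have hcs : ∀ a, a ≠ a₀ → c a = u a := fun a ha => Function.update_of_ne ha _ _
  have hc0 : c a₀ = n - ∑ a ∈ s, u a := Function.update_self _ _ _
  have hcsum : ∑ a, c a = n := by
    rw [← Finset.add_sum_erase _ _ (Finset.mem_univ a₀), hc0,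
      Finset.sum_congr rfl fun a ha => hcs a (Finset.ne_of_mem_erase ha), ← hs]
    exact Nat.sub_add_cancel hUn
  have hc0' : (c a₀ : ℝ) = n - ∑ a ∈ s, (u a : ℝ) := by
    rw [hc0, Nat.cast_sub hUn]
    push_cast
    rfl
  obtain ⟨x, hx⟩ := exists_symCount_eq c hcsum
  refine ⟨x, fun a => ?_⟩
  have hdiv : empDist x a - Q a = (c a - n * Q a) / n := by
    rw [empDist_apply, hx]
    field_simp
  have hgen : -m * m * Q a ≤ c a - n * Q a ∧ |(c a : ℝ) - n * Q a| ≤ m := by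
    by_cases ha : a = a₀
    · rw [ha, hc0', abs_le]
      refine ⟨?_, ?_, ?_⟩
      · nlinarith
      · linarith
      · linarith
    · rw [hcs a ha, abs_le]
      have h1 := hu1 a
      have h2 := hu2 a
      have h3 := mul_nonneg (mul_nonneg hm0.le hm0.le) (hQ.1 a)
      refine ⟨?_, ?_, ?_⟩ <;> linarith
  constructor
  · have h1 := div_le_div_of_nonneg_right hgen.1 hn'.le
    rw [← hdiv] at h1
    have h2 : -m * m * Q a / n = -(m ^ 2 / n) * Q a := by ring
    rw [h2] at h1
    linarith
  · rw [hdiv, abs_div, abs_of_pos hn']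
    exact div_le_div_of_nonneg_right hgen.2 hn'.le

end

open scoped Classical in
/-- The number of elements of a class. -/
def clsCard {U I : Type*} [Fintype U] (cls : U → I) (i : I) : ℕ :=
  (Finset.univ.filter fun u => cls u = i).card

lemma exists_cls_eq {U I : Type*} [Fintype U] {cls : U → I} {i : I} (h : clsCard cls i ≠ 0) :
    ∃ u, cls u = i := by
  classical
  obtain ⟨u, hu⟩ := Finset.card_pos.1 (Nat.pos_of_ne_zero h)
  exact ⟨u, (Finset.mem_filter.1 hu).2⟩

section Greedy

variable {U I J C : Type*} [Fintype U] [Fintype I] [Fintype J] {cls : U → I} {T : I → Finset C}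
  {lab : C → C → J} {π : I → I → J → ℝ}

open scoped Classical in
/-- One step of the greedy construction: a codeword with few neighbours of every label and
class among the codewords chosen before. -/
lemma exists_codeword_few_neighbours (hT : ∀ i, (T i).Nonempty) (hπ0 : ∀ i i' j, 0 ≤ π i i' j)
    (hπ : ∀ i i' j, ∀ x' ∈ T i',
      (((T i).filter fun x => lab x x' = j).card : ℝ) ≤ π i i' j * (T i).card)
    {K : ℝ} (hK : (Fintype.card I : ℝ) * Fintype.card J < K) (S : Finset U) {f : U → C}
    (hf : ∀ u, f u ∈ T (cls u)) (i : I) :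
    ∃ x ∈ T i, ∀ i' j, ((S.filter fun u => cls u = i' ∧ lab x (f u) = j).card : ℝ) ≤
      K * (clsCard cls i' * π i i' j) := by
  by_contra! hcon
  set cnt : C → I → J → ℕ := fun x i' j =>
    (S.filter fun u => cls u = i' ∧ lab x (f u) = j).card with hcnt
  set bad : I × J → Finset C := fun p =>
    (T i).filter fun x => K * (clsCard cls p.1 * π i p.1 p.2) < cnt x p.1 p.2 with hbad
  have hK0 : 0 < K := lt_of_le_of_lt (by positivity) hK
  have htotal : ∀ i' j, ∑ x ∈ T i, (cnt x i' j : ℝ) ≤ clsCard cls i' * π i i' j * (T i).card := by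
    intro i' j
    set S' := S.filter fun u => cls u = i' with hS'
    have h1 : ∑ x ∈ T i, cnt x i' j =
        ∑ u ∈ S', ((T i).filter fun x => lab x (f u) = j).card := by
      have := Finset.sum_card_bipartiteAbove_eq_sum_card_bipartiteBelow
        (s := T i) (t := S') (fun x u => lab x (f u) = j)
      simp only [Finset.bipartiteAbove, Finset.bipartiteBelow, hS', Finset.filter_filter] at this
      exact this
    have h2 : (S'.card : ℝ) ≤ clsCard cls i' := by
      rw [clsCard]
      exact_mod_cast Finset.card_le_card (Finset.filter_subset_filter _ (Finset.subset_univ S))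
    calc ∑ x ∈ T i, (cnt x i' j : ℝ)
        = ∑ u ∈ S', (((T i).filter fun x => lab x (f u) = j).card : ℝ) := by exact_mod_cast h1
      _ ≤ ∑ u ∈ S', π i i' j * (T i).card := by
          refine Finset.sum_le_sum fun u hu => hπ i i' j _ ?_
          have := hf u
          rwa [(Finset.mem_filter.1 hu).2] at this
      _ = S'.card * (π i i' j * (T i).card) := by rw [Finset.sum_const, nsmul_eq_mul]
      _ ≤ clsCard cls i' * (π i i' j * (T i).card) :=
          mul_le_mul_of_nonneg_right h2 (mul_nonneg (hπ0 _ _ _) (Nat.cast_nonneg _))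
      _ = _ := by ring
  have hbadcard : ∀ p, K * ((bad p).card : ℝ) ≤ (T i).card := by
    rintro ⟨i', j⟩
    set a : ℝ := clsCard cls i' * π i i' j with ha
    have ha0 : 0 ≤ a := mul_nonneg (Nat.cast_nonneg _) (hπ0 _ _ _)
    have h1 : ∑ x ∈ bad (i', j), (cnt x i' j : ℝ) ≤ a * (T i).card :=
      (Finset.sum_le_sum_of_subset_of_nonneg (Finset.filter_subset _ _)
        fun _ _ _ => Nat.cast_nonneg _).trans (htotal i' j)
    rcases ha0.eq_or_lt with h0 | h0
    · have h2 : bad (i', j) = ∅ := by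
        by_contra hne
        obtain ⟨x, hx⟩ := Finset.nonempty_iff_ne_empty.2 hne
        have h3 := Finset.single_le_sum (f := fun x => (cnt x i' j : ℝ))
          (fun _ _ => Nat.cast_nonneg _) hx
        have h4 := (Finset.mem_filter.1 hx).2
        simp only [← ha, ← h0, mul_zero, zero_mul] at h1 h4
        exact absurd (h4.trans_le (h3.trans h1)) (lt_irrefl _)
      simp [h2]
    · have h2 : ((bad (i', j)).card : ℝ) * (K * a) ≤ a * (T i).card := by
        refine le_trans ?_ h1
        rw [← nsmul_eq_mul]
        exact Finset.card_nsmul_le_sum _ _ _ fun x hx => (Finset.mem_filter.1 hx).2.le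
      refine le_of_mul_le_mul_left ?_ h0
      linarith
  have hcover : T i ⊆ Finset.univ.biUnion bad := by
    intro x hx
    obtain ⟨i', j, h⟩ := hcon x hx
    exact Finset.mem_biUnion.2 ⟨(i', j), Finset.mem_univ _, Finset.mem_filter.2 ⟨hx, h⟩⟩
  have h1 : ((T i).card : ℝ) ≤ ∑ p, ((bad p).card : ℝ) := by
    exact_mod_cast (Finset.card_le_card hcover).trans Finset.card_biUnion_le
  have h2 : K * ((T i).card : ℝ) ≤ (Fintype.card I : ℝ) * Fintype.card J * (T i).card := by
    calc K * ((T i).card : ℝ) ≤ K * ∑ p, ((bad p).card : ℝ) := by gcongr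
      _ = ∑ p, K * ((bad p).card : ℝ) := Finset.mul_sum _ _ _
      _ ≤ ∑ _p : I × J, ((T i).card : ℝ) := Finset.sum_le_sum fun p _ => hbadcard p
      _ = _ := by
        rw [Finset.sum_const, nsmul_eq_mul, Finset.card_univ, Fintype.card_prod]
        push_cast
        ring
  have h3 : (0 : ℝ) < (T i).card := by exact_mod_cast (hT i).card_pos
  exact absurd h2 (not_le.2 (mul_lt_mul_of_pos_right hK h3))

open scoped Classical in
/-- Greedy construction of a code in which the classes are processed by increasing size. -/
lemma exists_greedy_code (hT : ∀ i, (T i).Nonempty) (hπ0 : ∀ i i' j, 0 ≤ π i i' j)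
    (hπ : ∀ i i' j, ∀ x' ∈ T i',
      (((T i).filter fun x => lab x x' = j).card : ℝ) ≤ π i i' j * (T i).card)
    {K : ℝ} (hK : (Fintype.card I : ℝ) * Fintype.card J < K) (w : I → ℝ)
    {cost : C → C → ℝ} (hsymm : ∀ x x', cost x x' = cost x' x) {M : ℝ} (hM0 : 0 ≤ M)
    (hM : ∀ i i', clsCard cls i' ≤ clsCard cls i → ∀ x ∈ T i, ∀ x' ∈ T i',
      1 ≤ K * (clsCard cls i' * π i i' (lab x x')) →
      clsCard cls i * (K * (clsCard cls i' * π i i' (lab x x'))) * (w i * w i' * cost x x') ≤ M) :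
    ∃ f : U → C, (∀ u, f u ∈ T (cls u)) ∧
      ∑ u, ∑ u', (if u' = u then 0 else w (cls u) * w (cls u') * cost (f u) (f u')) ≤
        2 * ((Fintype.card I : ℝ) ^ 2 * Fintype.card J) * M := by
  have hcls : ∀ u, 0 < clsCard cls (cls u) := fun u => Finset.card_pos.2 ⟨u, by simp⟩
  have key : ∀ S : Finset U, ∃ f : U → C, (∀ u, f u ∈ T (cls u)) ∧
      ∑ u ∈ S, ∑ u' ∈ S, (if u' = u then 0 else w (cls u) * w (cls u') * cost (f u) (f u')) ≤
        ∑ u ∈ S, 2 * ((Fintype.card I : ℝ) * Fintype.card J) * (M / clsCard cls (cls u)) := by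
    intro S
    induction S using Finset.induction_on_max_value (fun u => clsCard cls (cls u)) with
    | empty => exact ⟨fun u => (hT (cls u)).choose, fun u => (hT (cls u)).choose_spec, by simp⟩
    | insert u₀ S hu₀ hmax ih =>
      obtain ⟨f, hf, hS⟩ := ih
      obtain ⟨x, hx, hfew⟩ := exists_codeword_few_neighbours hT hπ0 hπ hK S hf (cls u₀)
      have hN : (0 : ℝ) < clsCard cls (cls u₀) := by exact_mod_cast hcls u₀
      have hnew : ∑ u ∈ S, w (cls u₀) * w (cls u) * cost x (f u) ≤
          (Fintype.card I : ℝ) * Fintype.card J * (M / clsCard cls (cls u₀)) := by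
        rw [← Finset.sum_fiberwise S (fun u => (cls u, lab x (f u)))]
        have hfib : ∀ p : I × J, ∑ u ∈ S with (cls u, lab x (f u)) = p,
            w (cls u₀) * w (cls u) * cost x (f u) ≤ M / clsCard cls (cls u₀) := by
          rintro ⟨i', j⟩
          have hfil : (S.filter fun u => (cls u, lab x (f u)) = (i', j)) =
              S.filter fun u => cls u = i' ∧ lab x (f u) = j := by
            simp only [Prod.mk.injEq]
          rw [hfil]
          set S' := S.filter fun u => cls u = i' ∧ lab x (f u) = j with hS'
          set a : ℝ := K * (clsCard cls i' * π (cls u₀) i' j) with ha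
          have hcard : (S'.card : ℝ) ≤ a := hfew i' j
          rcases S'.eq_empty_or_nonempty with he | hne
          · rw [he, Finset.sum_empty]
            positivity
          · have h1 : 1 ≤ a := le_trans (by exact_mod_cast hne.card_pos) hcard
            have h2 : ∀ u ∈ S', w (cls u₀) * w (cls u) * cost x (f u) ≤
                M / clsCard cls (cls u₀) / a := by
              intro u hu
              obtain ⟨huS, hui, huj⟩ := Finset.mem_filter.1 hu
              have h3 := hM (cls u₀) (cls u) (hmax u huS) x hx (f u) (hf u)
              rw [hui, huj, ← ha] at h3
              rw [hui, div_div, le_div_iff₀ (by positivity), mul_comm]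
              exact h3 h1
            refine (Finset.sum_le_card_nsmul _ _ _ h2).trans ?_
            rw [nsmul_eq_mul, mul_div_assoc', div_le_iff₀ (by positivity), mul_comm]
            exact mul_le_mul_of_nonneg_left hcard (by positivity)
        refine (Finset.sum_le_card_nsmul _ _ _ fun p _ => hfib p).trans (le_of_eq ?_)
        rw [nsmul_eq_mul, Finset.card_univ, Fintype.card_prod]
        push_cast
        ring
      have hne : ∀ u ∈ S, u ≠ u₀ := fun u hu h => hu₀ (h ▸ hu)
      have hup : ∀ u ∈ S, Function.update f u₀ x u = f u := fun u hu =>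
        Function.update_of_ne (hne u hu) _ _
      refine ⟨Function.update f u₀ x, fun u => ?_, ?_⟩
      · by_cases h : u = u₀
        · rw [h, Function.update_self]
          exact hx
        · rw [Function.update_of_ne h]
          exact hf u
      · rw [Finset.sum_insert hu₀, Finset.sum_insert hu₀, Finset.sum_insert hu₀, if_pos rfl,
          zero_add, Function.update_self]
        have h1 : ∑ u ∈ S, (if u = u₀ then 0 else w (cls u₀) * w (cls u) *
            cost x (Function.update f u₀ x u)) = ∑ u ∈ S, w (cls u₀) * w (cls u) * cost x (f u) :=
          Finset.sum_congr rfl fun u hu => by rw [if_neg (hne u hu), hup u hu]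
        have h2 : ∑ u ∈ S, ∑ u' ∈ insert u₀ S, (if u' = u then 0 else w (cls u) * w (cls u') *
              cost (Function.update f u₀ x u) (Function.update f u₀ x u')) =
            ∑ u ∈ S, w (cls u₀) * w (cls u) * cost x (f u) +
            ∑ u ∈ S, ∑ u' ∈ S, (if u' = u then 0 else
              w (cls u) * w (cls u') * cost (f u) (f u')) := by
          rw [← Finset.sum_add_distrib]
          refine Finset.sum_congr rfl fun u hu => ?_
          rw [Finset.sum_insert hu₀, if_neg (hne u hu).symm, Function.update_self, hup u hu,
            hsymm (f u) x, mul_comm (w (cls u)) (w (cls u₀))]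
          congr 1
          refine Finset.sum_congr rfl fun u' hu' => ?_
          rw [hup u' hu']
        rw [h1, h2]
        linarith
  obtain ⟨f, hf, hsum⟩ := key Finset.univ
  refine ⟨f, hf, hsum.trans ?_⟩
  have h1 : ∑ u, M / (clsCard cls (cls u) : ℝ) ≤ Fintype.card I * M := by
    rw [← Finset.sum_fiberwise Finset.univ cls]
    have hfib : ∀ i, ∑ u with cls u = i, M / (clsCard cls (cls u) : ℝ) ≤ M := by
      intro i
      rw [Finset.sum_congr rfl fun u hu => by rw [(Finset.mem_filter.1 hu).2], Finset.sum_const,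
        nsmul_eq_mul]
      change (clsCard cls i : ℝ) * (M / clsCard cls i) ≤ M
      rw [mul_div_assoc']
      exact div_le_of_le_mul₀ (Nat.cast_nonneg _) hM0 (by rw [mul_comm])
    refine (Finset.sum_le_card_nsmul _ _ _ fun i _ => hfib i).trans (le_of_eq ?_)
    rw [nsmul_eq_mul, Finset.card_univ]
  rw [← Finset.mul_sum]
  calc 2 * ((Fintype.card I : ℝ) * Fintype.card J) * ∑ u, M / (clsCard cls (cls u) : ℝ)
      ≤ 2 * ((Fintype.card I : ℝ) * Fintype.card J) * (Fintype.card I * M) := by gcongr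
    _ = _ := by ring

end Greedy

/-- Bhattacharyya coefficient of two codewords. -/
def bhattProd {X Y : Type*} [Fintype Y] (W : X → Y → ℝ) {n : ℕ} (x x' : Fin n → X) : ℝ :=
  ∏ l, bhatt W (x l) (x' l)

/-- Joint letter counts of two sequences. -/
def jointCount {X : Type*} {n : ℕ} (x x' : Fin n → X) : X × X → Fin (n + 1) :=
  fun p => ⟨symCount (fun l => (x l, x' l)) p, Nat.lt_succ_of_le (symCount_le _ _)⟩

section

variable {V X Y : Type*} {PV : V → ℝ} {W : X → Y → ℝ} {k n : ℕ}

lemma jointCount_swap (x x' : Fin n → X) (p : X × X) :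
    jointCount x x' p = jointCount x' x p.swap := by
  classical
  simp only [jointCount, symCount, Fin.mk.injEq]
  congr 1
  ext l
  simp [Prod.ext_iff, and_comm]

variable [Fintype Y]

lemma bhattProd_nonneg (x x' : Fin n → X) : 0 ≤ bhattProd W x x' :=
  Finset.prod_nonneg fun _ _ => bhatt_nonneg _ _

lemma bhattProd_comm (x x' : Fin n → X) : bhattProd W x x' = bhattProd W x' x := by
  simp only [bhattProd, bhatt_comm]

lemma sum_sqrt_prodChan (hW : IsDMC W) (x x' : Fin n → X) :
    ∑ y : Fin n → Y, Real.sqrt (prodChan W x y) * Real.sqrt (prodChan W x' y) =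
      bhattProd W x x' := by
  classical
  simp only [bhattProd, bhatt]
  rw [Finset.prod_univ_sum, Fintype.piFinset_univ]
  refine Finset.sum_congr rfl fun y _ => ?_
  rw [prodChan, prodChan, ← Real.sqrt_mul (Finset.prod_nonneg fun l _ => (hW _).1 _),
    ← Finset.prod_mul_distrib]
  exact Real.sqrt_prod _ fun l _ => mul_nonneg ((hW _).1 _) ((hW _).1 _)

variable [Fintype V]

open scoped Classical in
/-- Union bound for maximum a posteriori decoding, in terms of Bhattacharyya coefficients. -/
lemma exists_decoder (hPV : PV ∈ stdSimplex ℝ V) (hW : IsDMC W) (f : (Fin k → V) → Fin n → X) :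
    ∃ φ : (Fin n → Y) → Fin k → V, pErr PV W f φ ≤
      ∑ v, ∑ v', (if v' = v then 0 else Real.sqrt (prodDist PV v) * Real.sqrt (prodDist PV v') *
        bhattProd W (f v) (f v')) := by
  have hV : Nonempty V := by
    by_contra h
    rw [not_nonempty_iff] at h
    simpa using hPV.2
  have hp : ∀ v : Fin k → V, 0 ≤ prodDist PV v := prodDist_nonneg hPV
  have hc : ∀ v y, 0 ≤ prodChan W (f v) y := fun v y => Finset.prod_nonneg fun l _ => (hW _).1 _
  choose φ hφ using fun y => Finite.exists_max fun v : Fin k → V =>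
    prodDist PV v * prodChan W (f v) y
  refine ⟨φ, Finset.sum_le_sum fun v _ => ?_⟩
  set g : (Fin k → V) → (Fin n → Y) → ℝ := fun v' y => if v' = v then 0 else
    (Real.sqrt (prodDist PV v) * Real.sqrt (prodDist PV v')) *
      (Real.sqrt (prodChan W (f v) y) * Real.sqrt (prodChan W (f v') y)) with hg
  have hg0 : ∀ v' y, 0 ≤ g v' y := by
    intro v' y
    simp only [hg]
    split_ifs <;> positivity
  calc prodDist PV v * ∑ y ∈ Finset.univ.filter (fun y => φ y ≠ v), prodChan W (f v) y
      = ∑ y ∈ Finset.univ.filter (fun y => φ y ≠ v), prodDist PV v * prodChan W (f v) y :=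
        Finset.mul_sum _ _ _
    _ ≤ ∑ y ∈ Finset.univ.filter (fun y => φ y ≠ v), ∑ v', g v' y := by
        refine Finset.sum_le_sum fun y hy => ?_
        refine le_trans ?_ (Finset.single_le_sum (f := fun v' => g v' y) (fun v' _ => hg0 v' y)
          (Finset.mem_univ (φ y)))
        simp only [hg]
        rw [if_neg (Finset.mem_filter.1 hy).2]
        have h1 : prodDist PV v * prodChan W (f v) y ≤
            Real.sqrt (prodDist PV v * prodChan W (f v) y) *
              Real.sqrt (prodDist PV (φ y) * prodChan W (f (φ y)) y) := by
          refine le_trans (le_of_eq (Real.mul_self_sqrt (mul_nonneg (hp v) (hc v y))).symm) ?_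
          exact mul_le_mul_of_nonneg_left (Real.sqrt_le_sqrt (hφ y v)) (Real.sqrt_nonneg _)
        rw [Real.sqrt_mul (hp _), Real.sqrt_mul (hp _)] at h1
        linarith
    _ ≤ ∑ y, ∑ v', g v' y :=
        Finset.sum_le_sum_of_subset_of_nonneg (Finset.filter_subset _ _)
          fun y _ _ => Finset.sum_nonneg fun v' _ => hg0 v' y
    _ = ∑ v', ∑ y, g v' y := Finset.sum_comm
    _ = _ := by
        refine Finset.sum_congr rfl fun v' _ => ?_
        simp only [hg]
        split_ifs with h
        · simp
        · rw [← Finset.mul_sum, sum_sqrt_prodChan hW]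

variable [Fintype X]

lemma bhattProd_eq_of_jointCount_eq {x₁ x₁' x₂ x₂' : Fin n → X}
    (h : jointCount x₁ x₁' = jointCount x₂ x₂') : bhattProd W x₁ x₁' = bhattProd W x₂ x₂' := by
  have h1 : ∀ x x' : Fin n → X, bhattProd W x x' =
      ∏ p : X × X, bhatt W p.1 p.2 ^ symCount (fun l => (x l, x' l)) p := fun x x' =>
    prod_comp_eq_prod_pow (fun p : X × X => bhatt W p.1 p.2) (fun l => (x l, x' l))
  rw [h1, h1]
  refine Finset.prod_congr rfl fun p _ => ?_
  have := congrArg Fin.val (congrFun h p)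
  simp only [jointCount] at this
  rw [this]

/-- The tilted Bhattacharyya coefficients of a codeword, summed over a type class. -/
lemma sum_bhattProd_rpow_le (hW : IsDMC W) (hn : n ≠ 0) {ρ : ℝ} (hρ : 0 < ρ)
    (x x₀ : Fin n → X) :
    ∑ x' ∈ countClass x₀, bhattProd W x x' ^ ρ⁻¹ ≤
      (countClass x₀).card * ((Real.exp 1 * (n + 1)) ^ Fintype.card X *
        Real.exp (-(n * exReal W (empDist x) ρ / ρ))) := by
  classical
  set A : ℝ := (Real.exp 1 * ((n : ℝ) + 1)) ^ Fintype.card X with hA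
  set N : ℝ := ((countClass x₀).card : ℝ) with hN
  have hQ' := empDist_mem_stdSimplex hn x₀
  have hQ := empDist_mem_stdSimplex hn x
  have hb : ∀ x' : Fin n → X, 0 ≤ bhattProd W x x' ^ ρ⁻¹ := fun x' =>
    Real.rpow_nonneg (bhattProd_nonneg _ _) _
  have hAN : 1 ≤ N * A * prodDist (empDist x₀) x₀ := by
    have := one_le_card_countClass_mul_prodDist hn x₀
    rw [← hA, ← hN] at this
    linarith
  have h1 : ∑ x' ∈ countClass x₀, bhattProd W x x' ^ ρ⁻¹ ≤
      N * A * ∑ x', prodDist (empDist x₀) x' * bhattProd W x x' ^ ρ⁻¹ := by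
    calc ∑ x' ∈ countClass x₀, bhattProd W x x' ^ ρ⁻¹
        ≤ ∑ x' ∈ countClass x₀, N * A * (prodDist (empDist x₀) x' * bhattProd W x x' ^ ρ⁻¹) := by
          refine Finset.sum_le_sum fun x' hx' => ?_
          rw [prodDist_eq_of_symCount_eq _ (mem_countClass.1 hx'), ← mul_assoc]
          exact le_mul_of_one_le_left (hb x') hAN
      _ ≤ ∑ x', N * A * (prodDist (empDist x₀) x' * bhattProd W x x' ^ ρ⁻¹) := by
          refine Finset.sum_le_sum_of_subset_of_nonneg (Finset.subset_univ _) fun x' _ _ => ?_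
          have := prodDist_nonneg hQ' x'
          have := hb x'
          positivity
      _ = _ := (Finset.mul_sum _ _ _).symm
  have h2 : ∑ x' : Fin n → X, prodDist (empDist x₀) x' * bhattProd W x x' ^ ρ⁻¹ =
      ∏ l, bhattAvg W ρ (empDist x₀) (x l) := by
    simp only [bhattAvg]
    rw [Finset.prod_univ_sum, Fintype.piFinset_univ]
    refine Finset.sum_congr rfl fun x' _ => ?_
    rw [Finset.prod_mul_distrib, bhattProd,
      ← Real.finsetProd_rpow _ _ fun l _ => bhatt_nonneg _ _]
    rfl
  have h3 : ∏ l, bhattAvg W ρ (empDist x₀) (x l) ≤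
      Real.exp (-(n * exReal W (empDist x) ρ / ρ)) := by
    by_cases hpos : ∀ a, 0 < empDist x a → 0 < bhattAvg W ρ (empDist x₀) a
    · rw [prod_comp_eq_exp x hpos, Real.exp_le_exp]
      have h4 := (coe_le_Ex'_iff hρ hQ).1 (coe_exReal hW hρ hQ).le _ hQ' hpos
      rw [mul_div_assoc, ← mul_neg]
      refine mul_le_mul_of_nonneg_left ?_ (Nat.cast_nonneg _)
      rw [le_neg, div_le_iff₀ hρ]
      linarith
    · push Not at hpos
      obtain ⟨a, ha, ha0⟩ := hpos
      have h4 : bhattAvg W ρ (empDist x₀) a = 0 := le_antisymm ha0 (bhattAvg_nonneg hQ' a)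
      have h5 : ∏ l, bhattAvg W ρ (empDist x₀) (x l) = 0 := by
        rw [prod_comp_eq_prod_pow]
        refine Finset.prod_eq_zero (Finset.mem_univ a) ?_
        rw [h4, zero_pow]
        rintro h6
        rw [empDist_apply, h6] at ha
        simp at ha
      rw [h5]
      exact (Real.exp_pos _).le
  refine h1.trans ?_
  rw [h2, mul_assoc]
  gcongr

open scoped Classical in
lemma card_jointCount_left_eq {x₁ x₂ : Fin n → X} (h : symCount x₁ = symCount x₂)
    (x₀ : Fin n → X) (j : X × X → Fin (n + 1)) :
    ((countClass x₀).filter fun x' => jointCount x₁ x' = j).card =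
      ((countClass x₀).filter fun x' => jointCount x₂ x' = j).card := by
  obtain ⟨σ, rfl⟩ := exists_perm_of_symCount_eq h
  have hj : ∀ x', jointCount (x₁ ∘ σ) (x' ∘ σ) = jointCount x₁ x' := by
    intro x'
    funext p
    simp only [jointCount, Fin.mk.injEq]
    exact congrFun (symCount_comp_perm (fun l => (x₁ l, x' l)) σ) p
  refine Finset.card_bij (fun x' _ => x' ∘ σ) ?_ ?_ ?_
  · intro x' hx'
    simp only [Finset.mem_filter, mem_countClass, symCount_comp_perm, hj] at hx' ⊢
    exact hx'
  · intro a _ b _ hab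
    exact σ.surjective.injective_comp_right hab
  · intro b hb
    refine ⟨b ∘ σ.symm, ?_, by funext i; simp⟩
    have h1 : (b ∘ σ.symm) ∘ σ = b := by funext i; simp
    simp only [Finset.mem_filter, mem_countClass, symCount_comp_perm] at hb ⊢
    rw [← hj, h1]
    exact hb

open scoped Classical in
lemma card_jointCount_right_eq {x₁ x₂ : Fin n → X} (h : symCount x₁ = symCount x₂)
    (x₀ : Fin n → X) (j : X × X → Fin (n + 1)) :
    ((countClass x₀).filter fun x => jointCount x x₁ = j).card =
      ((countClass x₀).filter fun x => jointCount x x₂ = j).card := by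
  have hs : ∀ x x' : Fin n → X, jointCount x x' = j ↔ jointCount x' x = fun p => j p.swap := by
    intro x x'
    constructor
    · rintro rfl
      funext p
      rw [jointCount_swap]
    · intro h
      funext p
      rw [jointCount_swap, h]
      exact congrArg j p.swap_swap
  simp only [hs]
  exact card_jointCount_left_eq h x₀ _

open scoped Classical in
lemma card_jointCount_swap (x₀ x₀' : Fin n → X) (j : X × X → Fin (n + 1)) :
    ((countClass x₀).filter fun x => jointCount x x₀' = j).card * (countClass x₀').card =
      ((countClass x₀').filter fun x' => jointCount x₀ x' = j).card * (countClass x₀).card := by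
  have h := Finset.sum_card_bipartiteAbove_eq_sum_card_bipartiteBelow
    (s := countClass x₀) (t := countClass x₀') (fun x x' => jointCount x x' = j)
  simp only [Finset.bipartiteAbove, Finset.bipartiteBelow] at h
  rw [Finset.sum_congr rfl fun x hx => card_jointCount_left_eq (mem_countClass.1 hx) x₀' j,
    Finset.sum_congr rfl fun x hx => card_jointCount_right_eq (mem_countClass.1 hx) x₀ j,
    Finset.sum_const, Finset.sum_const, smul_eq_mul, smul_eq_mul] at h
  rw [mul_comm, ← h, mul_comm]

end

/-- Exponentiating to `ρ ≥ 1` a count that is at least one. -/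
lemma mul_le_of_one_le_of_rpow_le {z c b A ρ : ℝ} (hρ : 1 ≤ ρ) (hc : 0 ≤ c) (hz : 0 ≤ z)
    (hb : 0 ≤ b) (h1 : 1 ≤ c * z) (h : z * b ^ ρ⁻¹ ≤ A) : c * z * b ≤ c ^ ρ * A ^ ρ := by
  have hρ0 : 0 < ρ := by linarith
  have h2 : (z * b ^ ρ⁻¹) ^ ρ = z ^ ρ * b := by
    rw [Real.mul_rpow hz (Real.rpow_nonneg hb _), ← Real.rpow_mul hb, inv_mul_cancel₀ hρ0.ne',
      Real.rpow_one]
  calc c * z * b ≤ (c * z) ^ ρ * b := by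
        refine mul_le_mul_of_nonneg_right ?_ hb
        have := Real.rpow_le_rpow_of_exponent_le h1 hρ
        rwa [Real.rpow_one] at this
    _ = c ^ ρ * (z * b ^ ρ⁻¹) ^ ρ := by rw [h2, Real.mul_rpow hc hz]; ring
    _ ≤ c ^ ρ * A ^ ρ := by
        refine mul_le_mul_of_nonneg_left ?_ (Real.rpow_nonneg hc _)
        exact Real.rpow_le_rpow (mul_nonneg hz (Real.rpow_nonneg hb _)) h hρ0.le

section

variable {V X Y : Type*} [Fintype V] [Fintype X] [Fintype Y] {PV : V → ℝ} {W : X → Y → ℝ}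
  {k n : ℕ}

open scoped Classical in
/-- The probability that a random member of the type class of `x₀` forms with `x₀'` a pair of
the given joint type. -/
def jointProb (x₀ x₀' : Fin n → X) (j : X × X → Fin (n + 1)) : ℝ :=
  (((countClass x₀).filter fun x => jointCount x x₀' = j).card : ℝ) / (countClass x₀).card

lemma card_countClass_pos (x₀ : Fin n → X) : (0 : ℝ) < (countClass x₀).card := by
  exact_mod_cast Finset.card_pos.2 ⟨x₀, self_mem_countClass x₀⟩

lemma jointProb_nonneg (x₀ x₀' : Fin n → X) (j : X × X → Fin (n + 1)) :
    0 ≤ jointProb x₀ x₀' j := by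
  unfold jointProb
  positivity

lemma jointProb_mul_rpow_le_right (hW : IsDMC W) (hn : n ≠ 0) {ρ : ℝ} (hρ : 0 < ρ)
    (x₀ x₀' x x' : Fin n → X) :
    jointProb x₀ x₀' (jointCount x x') * bhattProd W x x' ^ ρ⁻¹ ≤
      (Real.exp 1 * (n + 1)) ^ Fintype.card X *
        Real.exp (-(n * exReal W (empDist x₀') ρ / ρ)) := by
  classical
  rw [jointProb, div_mul_eq_mul_div, div_le_iff₀ (card_countClass_pos x₀), mul_comm _ (Nat.cast _)]
  refine le_trans ?_ (sum_bhattProd_rpow_le hW hn hρ x₀' x₀)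
  rw [← nsmul_eq_mul, ← Finset.sum_const]
  refine (Finset.sum_le_sum fun z hz => le_of_eq ?_).trans
    (Finset.sum_le_sum_of_subset_of_nonneg (Finset.filter_subset _ _)
      fun z _ _ => Real.rpow_nonneg (bhattProd_nonneg _ _) _)
  rw [bhattProd_comm x₀' z, bhattProd_eq_of_jointCount_eq (Finset.mem_filter.1 hz).2]

lemma jointProb_mul_rpow_le_left (hW : IsDMC W) (hn : n ≠ 0) {ρ : ℝ} (hρ : 0 < ρ)
    (x₀ x₀' x x' : Fin n → X) :
    jointProb x₀ x₀' (jointCount x x') * bhattProd W x x' ^ ρ⁻¹ ≤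
      (Real.exp 1 * (n + 1)) ^ Fintype.card X *
        Real.exp (-(n * exReal W (empDist x₀) ρ / ρ)) := by
  classical
  have hsw : jointProb x₀ x₀' (jointCount x x') =
      (((countClass x₀').filter fun z => jointCount x₀ z = jointCount x x').card : ℝ) /
        (countClass x₀').card := by
    rw [jointProb, div_eq_div_iff (card_countClass_pos x₀).ne' (card_countClass_pos x₀').ne']
    exact_mod_cast card_jointCount_swap x₀ x₀' (jointCount x x')
  rw [hsw, div_mul_eq_mul_div, div_le_iff₀ (card_countClass_pos x₀'), mul_comm _ (Nat.cast _)]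
  refine le_trans ?_ (sum_bhattProd_rpow_le hW hn hρ x₀ x₀')
  rw [← nsmul_eq_mul, ← Finset.sum_const]
  refine (Finset.sum_le_sum fun z hz => le_of_eq ?_).trans
    (Finset.sum_le_sum_of_subset_of_nonneg (Finset.filter_subset _ _)
      fun z _ _ => Real.rpow_nonneg (bhattProd_nonneg _ _) _)
  rw [bhattProd_eq_of_jointCount_eq (Finset.mem_filter.1 hz).2]

lemma card_mul_prodDist_le (hPV : PV ∈ stdSimplex ℝ V) (hk : k ≠ 0) (v : Fin k → V)
    (hac : ∀ a, PV a = 0 → empDist v a = 0) :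
    ((countClass v).card : ℝ) * prodDist PV v ≤ Real.exp (-(k * srcDiv PV (empDist v))) := by
  have hpos : ∀ a, 0 < empDist v a → 0 < PV a := fun a ha =>
    lt_of_le_of_ne (hPV.1 a) fun h => ha.ne' (hac a h.symm)
  have h : Real.exp (-(k * srcDiv PV (empDist v))) =
      Real.exp (k * entH (empDist v)) * prodDist PV v := by
    rw [prodDist, prod_comp_eq_exp v hpos, ← Real.exp_add, srcDiv]
    congr 1
    ring
  rw [h]
  exact mul_le_mul_of_nonneg_right (card_countClass_le hk v) (prodDist_nonneg hPV v)

lemma prodDist_eq_zero (v : Fin k → V) (hac : ¬ ∀ a, PV a = 0 → empDist v a = 0) :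
    prodDist PV v = 0 := by
  push Not at hac
  obtain ⟨a, ha, hv⟩ := hac
  rw [prodDist, prod_comp_eq_prod_pow]
  refine Finset.prod_eq_zero (Finset.mem_univ a) ?_
  rw [ha, zero_pow]
  intro h
  rw [empDist_apply, h] at hv
  simp at hv

/-- The contribution of one source type to the union bound. -/
lemma card_mul_contribution_le (hPV : PV ∈ stdSimplex ℝ V) (hk : k ≠ 0) (v : Fin k → V)
    (hac : ∀ a, PV a = 0 → empDist v a = 0) {K A ρ ρb e z b M₀ : ℝ} (hK : 1 ≤ K) (hA : 1 ≤ A)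
    (hρ : 1 ≤ ρ) (hρb : ρ ≤ ρb) (hz : 0 ≤ z) (hb : 0 ≤ b)
    (h1 : 1 ≤ K * ((countClass v).card * z))
    (hzb : z * b ^ ρ⁻¹ ≤ A * Real.exp (-(n * e / ρ)))
    (hM₀ : Real.exp (-(k * srcDiv PV (empDist v)) + ρ * (k * entH (empDist v)) - n * e) ≤ M₀) :
    ((countClass v).card * prodDist PV v) * (K * ((countClass v).card * z) * b) ≤
      (K * A) ^ ρb * M₀ := by
  have hρ0 : 0 < ρ := by linarith
  set N : ℝ := ((countClass v).card : ℝ) with hN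
  have hN0 : 0 < N := card_countClass_pos v
  have h2 : K * (N * z) * b ≤ (K * N) ^ ρ * (A * Real.exp (-(n * e / ρ))) ^ ρ := by
    rw [← mul_assoc]
    exact mul_le_of_one_le_of_rpow_le hρ (by positivity) hz hb (by rwa [mul_assoc]) hzb
  have h3 : (K * N) ^ ρ * (A * Real.exp (-(n * e / ρ))) ^ ρ =
      (K * A) ^ ρ * (N ^ ρ * Real.exp (-(n * e))) := by
    rw [Real.mul_rpow (by positivity) hN0.le, Real.mul_rpow (by positivity) (Real.exp_pos _).le,
      Real.mul_rpow (by positivity) (by positivity), ← Real.exp_mul]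
    have : -(n * e / ρ) * ρ = -(n * e) := by field_simp
    rw [this]
    ring
  have h4 : N ^ ρ ≤ Real.exp (ρ * (k * entH (empDist v))) := by
    refine (Real.rpow_le_rpow hN0.le (card_countClass_le hk v) hρ0.le).trans (le_of_eq ?_)
    rw [← Real.exp_mul, mul_comm]
  have hKA : 1 ≤ K * A := one_le_mul_of_one_le_of_one_le hK hA
  have hp := prodDist_nonneg hPV v
  calc N * prodDist PV v * (K * (N * z) * b)
      ≤ Real.exp (-(k * srcDiv PV (empDist v))) *
          ((K * A) ^ ρb * (Real.exp (ρ * (k * entH (empDist v))) * Real.exp (-(n * e)))) := by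
        refine mul_le_mul (card_mul_prodDist_le hPV hk v hac) ?_ (by positivity)
          (Real.exp_pos _).le
        rw [h3] at h2
        refine h2.trans ?_
        have h5 : (K * A) ^ ρ ≤ (K * A) ^ ρb := Real.rpow_le_rpow_of_exponent_le hKA hρb
        gcongr
    _ = (K * A) ^ ρb *
          Real.exp (-(k * srcDiv PV (empDist v)) + ρ * (k * entH (empDist v)) - n * e) := by
        rw [sub_eq_add_neg, Real.exp_add, Real.exp_add]
        ring
    _ ≤ _ := by gcongr

/-- Existence of a code whose codewords have prescribed compositions, with an error bound in
terms of the worst source type. -/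
lemma exists_code (hPV : PV ∈ stdSimplex ℝ V) (hW : IsDMC W) (hk : k ≠ 0) (hn : n ≠ 0)
    (xc : (V → ℝ) → Fin n → X) {ρb M₀ : ℝ} (hM₀ : 0 ≤ M₀)
    (h : ∀ v : Fin k → V, (∀ a, PV a = 0 → empDist v a = 0) → ∃ ρ : ℝ, 1 ≤ ρ ∧ ρ ≤ ρb ∧
      Real.exp (-(k * srcDiv PV (empDist v)) + ρ * (k * entH (empDist v)) -
        n * exReal W (empDist (xc (empDist v))) ρ) ≤ M₀) :
    ∃ (f : (Fin k → V) → Fin n → X) (φ : (Fin n → Y) → Fin k → V),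
      (∀ v, symCount (f v) = symCount (xc (empDist v))) ∧
      pErr PV W f φ ≤ 2 * ((((k : ℝ) + 1) ^ Fintype.card V) ^ 2 *
          ((n : ℝ) + 1) ^ (Fintype.card X * Fintype.card X)) *
        (((((k : ℝ) + 1) ^ Fintype.card V * ((n : ℝ) + 1) ^ (Fintype.card X * Fintype.card X) + 1) *
          (Real.exp 1 * (n + 1)) ^ Fintype.card X) ^ ρb * M₀) := by
  classical
  set cls : (Fin k → V) → V → Fin (k + 1) := fun v a =>
    ⟨symCount v a, Nat.lt_succ_of_le (symCount_le v a)⟩ with hcls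
  set xr : (V → Fin (k + 1)) → Fin n → X := fun i => xc fun a => ((i a : ℕ) : ℝ) / k with hxr
  set w : (V → Fin (k + 1)) → ℝ := fun i => Real.sqrt (∏ a, PV a ^ (i a : ℕ)) with hw
  have hxrcls : ∀ v, xr (cls v) = xc (empDist v) := fun v => rfl
  have hwcls : ∀ v, w (cls v) = Real.sqrt (prodDist PV v) := fun v => by
    rw [prodDist, prod_comp_eq_prod_pow]
  have hclscard : ∀ v, clsCard cls (cls v) = (countClass v).card := by
    intro v
    rw [clsCard]
    congr 1
    ext v'
    simp only [Finset.mem_filter, Finset.mem_univ, true_and, mem_countClass]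
    constructor
    · intro hv
      funext a
      have := congrArg Fin.val (congrFun hv a)
      simpa [hcls] using this
    · intro hv
      funext a
      simp [hcls, hv]
  have hIcard : (Fintype.card (V → Fin (k + 1)) : ℝ) = ((k : ℝ) + 1) ^ Fintype.card V := by
    rw [Fintype.card_fun, Fintype.card_fin]
    push_cast
    rfl
  have hJcard : (Fintype.card (X × X → Fin (n + 1)) : ℝ) =
      ((n : ℝ) + 1) ^ (Fintype.card X * Fintype.card X) := by
    rw [Fintype.card_fun, Fintype.card_fin, Fintype.card_prod]
    push_cast
    rfl
  rw [← hIcard, ← hJcard]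
  set K : ℝ := (Fintype.card (V → Fin (k + 1)) : ℝ) * Fintype.card (X × X → Fin (n + 1)) + 1
    with hK
  set A : ℝ := (Real.exp 1 * ((n : ℝ) + 1)) ^ Fintype.card X with hA
  have hK1 : 1 ≤ K := by
    rw [hK]
    have : (0 : ℝ) ≤ (Fintype.card (V → Fin (k + 1)) : ℝ) * Fintype.card (X × X → Fin (n + 1)) := by
      positivity
    linarith
  have hA1 : 1 ≤ A := by
    refine one_le_pow₀ (one_le_mul_of_one_le_of_one_le (Real.one_le_exp zero_le_one) ?_)
    linarith [n.cast_nonneg (α := ℝ)]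
  have hM : 0 ≤ (K * A) ^ ρb * M₀ := by positivity
  obtain ⟨f, hf, hsum⟩ := exists_greedy_code (cls := cls) (T := fun i => countClass (xr i))
    (lab := jointCount) (π := fun i i' j => jointProb (xr i) (xr i') j)
    (fun i => ⟨xr i, self_mem_countClass _⟩) (fun i i' j => jointProb_nonneg _ _ _)
    (fun i i' j x' hx' => by
      rw [jointProb, div_mul_cancel₀ _ (card_countClass_pos _).ne']
      refine Nat.cast_le.2 (le_of_eq ?_)
      convert card_jointCount_right_eq (mem_countClass.1 hx') (xr i) j)
    (lt_add_one _ : _ < K) w (cost := bhattProd W) bhattProd_comm hM (by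
      intro i i' hle x hx x' hx' h1
      set z : ℝ := jointProb (xr i) (xr i') (jointCount x x') with hz
      set b : ℝ := bhattProd W x x' with hb
      have hz0 : 0 ≤ z := jointProb_nonneg _ _ _
      have hb0 : 0 ≤ b := bhattProd_nonneg _ _
      have hi' : clsCard cls i' ≠ 0 := by
        intro h0
        rw [h0] at h1
        norm_num at h1
      obtain ⟨v, rfl⟩ := exists_cls_eq (show clsCard cls i ≠ 0 by omega)
      obtain ⟨v', rfl⟩ := exists_cls_eq hi'
      rw [hwcls, hwcls, hclscard, hclscard]
      rw [hclscard, hclscard] at hle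
      rw [hclscard] at h1
      have hle' : ((countClass v').card : ℝ) ≤ (countClass v).card := by exact_mod_cast hle
      have h2 : 1 ≤ K * ((countClass v).card * z) := by
        refine h1.trans ?_
        gcongr
      by_cases hac : ∀ a, PV a = 0 → empDist v a = 0
      swap
      · rw [prodDist_eq_zero v hac, Real.sqrt_zero]
        simpa using hM
      by_cases hac' : ∀ a, PV a = 0 → empDist v' a = 0
      swap
      · rw [prodDist_eq_zero v' hac', Real.sqrt_zero]
        simpa using hM
      obtain ⟨ρ, hρ, hρb, hE⟩ := h v hac
      obtain ⟨ρ', hρ', hρb', hE'⟩ := h v' hac'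
      have hs := card_mul_contribution_le (n := n) hPV hk v hac hK1 hA1 hρ hρb hz0 hb0 h2
        (jointProb_mul_rpow_le_left hW hn (by linarith) _ _ _ _) hE
      have hs' := card_mul_contribution_le (n := n) hPV hk v' hac' hK1 hA1 hρ' hρb' hz0 hb0 h1
        (jointProb_mul_rpow_le_right hW hn (by linarith) _ _ _ _) hE'
      refine (le_abs_self _).trans (abs_le_of_sq_le_sq ?_ hM)
      have hp := prodDist_nonneg hPV v
      have hp' := prodDist_nonneg hPV v'
      refine le_trans (le_of_eq ?_) ((mul_le_mul hs hs' (by positivity) hM).trans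
        (le_of_eq (sq _).symm))
      have hq := Real.sq_sqrt hp
      have hq' := Real.sq_sqrt hp'
      simp only [mul_pow]
      rw [hq, hq']
      ring)
  obtain ⟨φ, hφ⟩ := exists_decoder (Y := Y) hPV hW f
  refine ⟨f, φ, fun v => ?_, hφ.trans ?_⟩
  · rw [← hxrcls]
    exact mem_countClass.1 (hf v)
  · simp only [hwcls] at hsum
    exact hsum

end

/-- The combinatorial factors of the code construction are subexponential. -/
lemma eventually_factor_le_exp {t ρb η : ℝ} (ht : 0 < t) (hρb : 1 ≤ ρb) (hη : 0 < η) (C : ℝ)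
    (r m : ℕ) :
    ∀ᶠ n : ℕ in atTop, ∀ k : ℕ, (k : ℝ) ≤ t * n →
      2 * ((((k : ℝ) + 1) ^ r) ^ 2 * ((n : ℝ) + 1) ^ (m * m)) *
        (((((k : ℝ) + 1) ^ r * ((n : ℝ) + 1) ^ (m * m) + 1) *
          (Real.exp 1 * (n + 1)) ^ m) ^ ρb * Real.exp C) ≤ Real.exp (η * n) := by
  set c : ℝ := Real.exp 1 + t with hc
  have he : 2 ≤ Real.exp 1 := by linarith [Real.add_one_le_exp (1 : ℝ)]
  have hc0 : 0 < c := by positivity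
  set s : ℝ := (1 + r * 2 + m * m : ℕ) + (r + m * m + 1 + m : ℕ) * ρb with hs
  have hlim : Tendsto (fun n : ℕ => c * ((n : ℝ) + 1)) atTop atTop :=
    (tendsto_atTop_add_const_right _ 1 tendsto_natCast_atTop_atTop).const_mul_atTop hc0
  have ho := (isLittleO_rpow_exp_pos_mul_atTop s (div_pos hη hc0)).comp_tendsto hlim
  filter_upwards [ho.def (Real.exp_pos (-C - η))] with n hn k hk
  have hn0 : (0 : ℝ) ≤ n := Nat.cast_nonneg _
  have hk0 : (0 : ℝ) ≤ k := Nat.cast_nonneg _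
  set B : ℝ := c * ((n : ℝ) + 1) with hB
  have hBe : Real.exp 1 * ((n : ℝ) + 1) ≤ B := by
    rw [hB, hc]
    nlinarith
  have hB2 : 2 ≤ B := by nlinarith
  have hB0 : 0 < B := by linarith
  have hBn : (n : ℝ) + 1 ≤ B := by nlinarith
  have hBk : (k : ℝ) + 1 ≤ B := by
    rw [hB, hc]
    nlinarith
  have h1 : (((k : ℝ) + 1) ^ r * ((n : ℝ) + 1) ^ (m * m) + 1) * (Real.exp 1 * (n + 1)) ^ m ≤
      B ^ (r + m * m + 1 + m) := by
    have h2 : (((k : ℝ) + 1) ^ r * ((n : ℝ) + 1) ^ (m * m)) ≤ B ^ (r + m * m) := by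
      rw [pow_add]
      gcongr
    have h3 : 1 ≤ B ^ (r + m * m) := one_le_pow₀ (by linarith)
    rw [pow_add B (r + m * m + 1) m, pow_succ]
    gcongr
    nlinarith
  have h4 : 2 * ((((k : ℝ) + 1) ^ r) ^ 2 * ((n : ℝ) + 1) ^ (m * m)) ≤ B ^ (1 + r * 2 + m * m) := by
    rw [pow_add, pow_add, pow_one, ← pow_mul, ← mul_assoc]
    gcongr
  have h5 : B ^ s ≤ Real.exp (-C - η) * Real.exp (η * (n + 1)) := by
    simp only [Function.comp_apply, Real.norm_eq_abs, Real.abs_exp] at hn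
    rw [abs_of_nonneg (Real.rpow_nonneg hB0.le _)] at hn
    have : η / c * B = η * (n + 1) := by
      rw [hB]
      field_simp
    rwa [this] at hn
  calc _ ≤ B ^ (1 + r * 2 + m * m) * ((B ^ (r + m * m + 1 + m)) ^ ρb * Real.exp C) := by
        refine mul_le_mul h4 ?_ (by positivity) (by positivity)
        refine mul_le_mul_of_nonneg_right ?_ (Real.exp_pos _).le
        exact Real.rpow_le_rpow (by positivity) h1 (by linarith)
    _ = B ^ s * Real.exp C := by
        rw [hs, Real.rpow_add hB0, Real.rpow_natCast, Real.rpow_mul hB0.le, Real.rpow_natCast]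
        ring
    _ ≤ Real.exp (-C - η) * Real.exp (η * (n + 1)) * Real.exp C := by gcongr
    _ = Real.exp (η * n) := by
        rw [← Real.exp_add, ← Real.exp_add]
        congr 1
        ring

section

variable {V X Y : Type*} [Fintype V] [Fintype X] [Fintype Y] {PV : V → ℝ} {W : X → Y → ℝ}

lemma exists_abs_srcDiv_le (PV : V → ℝ) :
    ∃ C : ℝ, ∀ P ∈ stdSimplex ℝ V, |srcDiv PV P| ≤ C := by
  obtain ⟨C, hC⟩ := (isCompact_stdSimplex ℝ V).exists_bound_of_continuousOn
    (continuous_srcDiv (PV := PV)).continuousOn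
  exact ⟨C, fun P hP => by simpa using hC P hP⟩

/-- Rounding a codeword distribution to a type hardly changes the expurgated function. -/
lemma exReal_sub_le_of_near (hW : IsDMC W) {n : ℕ} (hn : Fintype.card X ^ 2 < n) {Q : X → ℝ}
    (hQ : Q ∈ stdSimplex ℝ X) {x : Fin n → X}
    (hx : ∀ a, (1 - (Fintype.card X : ℝ) ^ 2 / n) * Q a ≤ empDist x a) {ρ ρb : ℝ} (hρ : 1 ≤ ρ)
    (hρb : ρ ≤ ρb) :
    n * exReal W Q ρ - (Fintype.card X : ℝ) ^ 2 * (ρb * Real.log (Fintype.card X)) ≤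
      n * exReal W (empDist x) ρ := by
  have hn0 : n ≠ 0 := by omega
  have hn' : (0 : ℝ) < n := by positivity
  have hε : (Fintype.card X : ℝ) ^ 2 / n < 1 := by
    rw [div_lt_one hn']
    exact_mod_cast hn
  have hR := empDist_mem_stdSimplex hn0 x
  have h1 := le_Ex'_of_le hW (by linarith) hQ hR hε hx (coe_exReal hW (by linarith : 0 < ρ) hQ).le
  rw [← coe_exReal hW (by linarith) hR, EReal.coe_le_coe_iff] at h1
  have h2 : exReal W Q ρ ≤ ρb * Real.log (Fintype.card X) :=
    (exReal_le hW (by linarith) hQ).trans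
      (mul_le_mul_of_nonneg_right hρb (Real.log_natCast_nonneg _))
  have h3 := mul_le_mul_of_nonneg_left h1 hn'.le
  have h4 : (n : ℝ) * ((1 - (Fintype.card X : ℝ) ^ 2 / n) * exReal W Q ρ) =
      n * exReal W Q ρ - (Fintype.card X : ℝ) ^ 2 * exReal W Q ρ := by
    field_simp
  have h5 := mul_le_mul_of_nonneg_left h2 (sq_nonneg (Fintype.card X : ℝ))
  linarith

/-- The exponent of a source type for blocklength `n` and `⌊tn⌋` source letters. -/
lemma exp_le_of_le_typeExp {t : ℝ} {n k : ℕ} (hk : (k : ℝ) ≤ t * n)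
    (hk' : t * n ≤ k + 1) {P : V → ℝ} (hP : P ∈ stdSimplex ℝ V) {Q R : X → ℝ}
    {E₁ C₀ C₁ ρ : ℝ} (hρ : 1 ≤ ρ) (hC₀ : |srcDiv PV P| ≤ C₀)
    (hE : E₁ ≤ typeExp PV W t P Q ρ) (hR : n * exReal W Q ρ - C₁ ≤ n * exReal W R ρ) :
    Real.exp (-(k * srcDiv PV P) + ρ * (k * entH P) - n * exReal W R ρ) ≤
      Real.exp (C₀ + C₁) * Real.exp (-(n * E₁)) := by
  rw [← Real.exp_add, Real.exp_le_exp]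
  have h1 := mul_le_mul_of_nonneg_left hE (Nat.cast_nonneg n : (0 : ℝ) ≤ n)
  rw [typeExp] at h1
  have h2 : ρ * (k * entH P) ≤ ρ * (t * n * entH P) :=
    mul_le_mul_of_nonneg_left (mul_le_mul_of_nonneg_right hk (entH_nonneg hP)) (by linarith)
  have h3 : (t * n - k) * srcDiv PV P ≤ C₀ := by
    have h4 : |(t * n - k) * srcDiv PV P| ≤ 1 * |srcDiv PV P| := by
      rw [abs_mul, abs_of_nonneg (by linarith : 0 ≤ t * n - k)]
      exact mul_le_mul_of_nonneg_right (by linarith) (abs_nonneg _)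
    linarith [le_abs_self ((t * n - k) * srcDiv PV P)]
  linarith

end

end

end JSCC

theorem stmt9 {V X Y : Type*} [Fintype V] [Fintype X] [Fintype Y] [Nonempty X]
    (PV : V → ℝ) (hPV : PV ∈ stdSimplex ℝ V) (W : X → Y → ℝ) (hW : JSCC.IsDMC W)
    (t : ℝ) (ht : 0 < t)
    (Qi : (V → ℝ) → X → ℝ)
    (hQi : ∀ P ∈ stdSimplex ℝ V, JSCC.HasArgmax PV W t P → JSCC.IsArgmax PV W t P (Qi P))
    (E : ℝ) (hE : (E : EReal) < JSCC.exponent PV W t) (δ : ℝ) (hδ : 0 < δ) :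
    ∃ n₀ : ℕ, ∀ n : ℕ, n₀ ≤ n →
      ∃ (Qc : (V → ℝ) → X → ℝ)
        (f : (Fin ⌊t * (n : ℝ)⌋₊ → V) → Fin n → X)
        (φ : (Fin n → Y) → Fin ⌊t * (n : ℝ)⌋₊ → V),
        (∀ P : V → ℝ, JSCC.IsType ⌊t * (n : ℝ)⌋₊ P →
          JSCC.IsType n (Qc P) ∧
          (JSCC.HasArgmax PV W t P → ∀ x, |Qc P x - Qi P x| ≤ δ)) ∧
        (∀ v, f v ∈ JSCC.typeClass n (Qc (JSCC.empDist v))) ∧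
        JSCC.pErr PV W f φ ≤ Real.exp (-(n : ℝ) * E) := by
  open JSCC Filter in
  obtain ⟨E₁, hE₁, ρb, hρb, hpar⟩ := exists_bounded_parameter hPV hW ht hQi hE (half_pos hδ)
  obtain ⟨C₀, hC₀⟩ := exists_abs_srcDiv_le PV
  set m : ℝ := (Fintype.card X : ℝ) with hm
  set C₁ : ℝ := m ^ 2 * (ρb * Real.log m) with hC₁
  rw [← eventually_atTop]
  filter_upwards [eventually_factor_le_exp ht hρb (sub_pos.2 hE₁) (C₀ + C₁) (Fintype.card V)
      (Fintype.card X), eventually_gt_atTop (Fintype.card X ^ 2),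
    tendsto_natCast_atTop_atTop.eventually_ge_atTop (m / (δ / 2)),
    tendsto_natCast_atTop_atTop.eventually_ge_atTop (1 / t)] with n hfac hn hnδ hnt
  set k : ℕ := ⌊t * (n : ℝ)⌋₊ with hk
  have hn0 : n ≠ 0 := by omega
  have hn' : (0 : ℝ) < n := by positivity
  have hk1 : (k : ℝ) ≤ t * n := Nat.floor_le (by positivity)
  have hk2 : t * n ≤ k + 1 := (Nat.lt_floor_add_one _).le
  have hk0 : k ≠ 0 := by
    rw [div_le_iff₀ ht] at hnt
    exact (Nat.floor_pos.2 (by linarith)).ne'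
  have hmδ : m / n ≤ δ / 2 := by
    rw [div_le_iff₀ (half_pos hδ)] at hnδ
    rw [div_le_iff₀ hn']
    linarith
  have hround : ∀ P : V → ℝ, ∃ x : Fin n → X, P ∈ stdSimplex ℝ V →
      (HasArgmax PV W t P → ∀ a, |empDist x a - Qi P a| ≤ δ) ∧
      ((∀ v, PV v = 0 → P v = 0) → ∃ ρ : ℝ, 1 ≤ ρ ∧ ρ ≤ ρb ∧
        Real.exp (-(k * srcDiv PV P) + ρ * (k * entH P) - n * exReal W (empDist x) ρ) ≤
          Real.exp (C₀ + C₁) * Real.exp (-(n * E₁))) := by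
    intro P
    by_cases hP : P ∈ stdSimplex ℝ V
    swap
    · exact ⟨fun _ => Classical.arbitrary X, fun h => absurd h hP⟩
    by_cases hac : ∀ v, PV v = 0 → P v = 0
    · obtain ⟨Q, hQ, ρ, hρ, hρ', hexp, hclose⟩ := hpar P hP hac
      obtain ⟨x, hx⟩ := exists_empDist_near hQ hn.le
      refine ⟨x, fun _ => ⟨fun hreg a => ?_, fun _ => ⟨ρ, hρ, hρ', ?_⟩⟩⟩
      · have h1 := abs_sub_le (empDist x a) (Q a) (Qi P a)
        linarith [(hx a).2, hclose hreg a]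
      · exact exp_le_of_le_typeExp hk1 hk2 hP hρ (hC₀ P hP) hexp
          (exReal_sub_le_of_near hW hn hQ (fun a => (hx a).1) hρ hρ')
    · by_cases hreg : HasArgmax PV W t P
      · obtain ⟨x, hx⟩ := exists_empDist_near (hQi P hP hreg).1 hn.le
        exact ⟨x, fun _ => ⟨fun _ a => by linarith [(hx a).2], fun h => absurd h hac⟩⟩
      · exact ⟨fun _ => Classical.arbitrary X, fun _ =>
          ⟨fun h => absurd h hreg, fun h => absurd h hac⟩⟩
  choose xc hxc using hround
  obtain ⟨f, φ, hf, herr⟩ := exists_code (M₀ := Real.exp (C₀ + C₁) * Real.exp (-(n * E₁)))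
    hPV hW hk0 hn0 xc (by positivity)
    fun v hac => (hxc _ (empDist_mem_stdSimplex hk0 v)).2 hac
  refine ⟨fun P => empDist (xc P), f, φ, fun P hP => ⟨⟨xc P, rfl⟩, ?_⟩,
    fun v => empDist_eq_iff.2 (hf v), herr.trans ?_⟩
  · obtain ⟨v, rfl⟩ := hP
    exact (hxc _ (empDist_mem_stdSimplex hk0 v)).1
  · have h1 := mul_le_mul_of_nonneg_right (hfac k hk1) (Real.exp_pos (-(n * E₁))).le
    refine le_trans (le_of_eq ?_) (h1.trans (le_of_eq ?_))
    · ring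
    · rw [← Real.exp_add]
      congr 1
      ring
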